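/- Assume f : ℝ → ℝ is continuous and satisfies (A1): s f(s) > 0 for all s ≠ 0, and (A2): the limits f_0 = lim_{|s|→0} f(s)/φ_p(s) and f_∞ = lim_{|s|→∞} f(s)/φ_p(s) exist and lie in (0, +∞). Suppose for some k ∈ ℕ and ν ∈ {+,−} either λ_k^ν/f_∞ < r < λ_k^ν/f_0 or λ_k^ν/f_0 < r < λ_k^ν/f_∞. Then the problem (φ_p(u'))' + r a(x) f(u) + α(x) φ_p(u⁺) + β(x) φ_p(u⁻) = 0 on (0,1), u(0) = u(1) = 0, has a solution u_k^ν such that u_k^ν has exactly k−1 zeros in (0,1) and ν u_k^ν is positive near 0. -/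

import Mathlib

open Set Filter Topology

/-- `φ_p(s) = |s|^{p-2} s`. -/
noncomputable def phip (p s : ℝ) : ℝ := |s| ^ (p - 2) * s

/-- membership in the space `E = {u ∈ C¹[0,1] : u 0 = u 1 = 0}`. -/
def MemE (u : ℝ → ℝ) : Prop := ContDiff ℝ 1 u ∧ u 0 = 0 ∧ u 1 = 0

/-- `u` is nontrivial on `[0,1]`. -/
def Nontriv (u : ℝ → ℝ) : Prop := ∃ x ∈ Set.Icc (0:ℝ) 1, u x ≠ 0

/-- `u ∈ S_k^ν` (ν = 1 or -1): u ∈ E, exactly k-1 interior zeros in (0,1), all zeros of u in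
[0,1] simple, and ν·u positive near 0. -/
def MemS (k : ℕ) (ν : ℝ) (u : ℝ → ℝ) : Prop :=
  MemE u ∧
  {x ∈ Ioo (0:ℝ) 1 | u x = 0}.Finite ∧
  {x ∈ Ioo (0:ℝ) 1 | u x = 0}.ncard = k - 1 ∧
  (∀ x ∈ Icc (0:ℝ) 1, u x = 0 → deriv u x ≠ 0) ∧
  ∃ δ > 0, ∀ x ∈ Ioo (0:ℝ) δ, 0 < ν * u x

/-- the `C¹` norm `‖u‖ = max_{[0,1]} |u| + max_{[0,1]} |u'|` of `E`. -/
noncomputable def normE (u : ℝ → ℝ) : ℝ :=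
  (⨆ x : Icc (0:ℝ) 1, |u x|) + (⨆ x : Icc (0:ℝ) 1, |deriv u x|)

/-- `u` solves `-(φ_p(u'))' = λ a φ_p(u) + α φ_p(u⁺) + β φ_p(u⁻)` on (0,1), u(0)=u(1)=0. -/
def IsHalfSol (p : ℝ) (a α β : ℝ → ℝ) (lam : ℝ) (u : ℝ → ℝ) : Prop :=
  MemE u ∧ ∀ x ∈ Set.Ioo (0:ℝ) 1,
    HasDerivAt (fun y => phip p (deriv u y))
      (-(lam * a x * phip p (u x) + α x * phip p (max (u x) 0)
         + β x * phip p (-min (u x) 0))) x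

/-- `u` solves `(φ_p(u'))' + r a f(u) + α φ_p(u⁺) + β φ_p(u⁻) = 0` on (0,1), u(0)=u(1)=0. -/
def IsSolNod (p r : ℝ) (a α β : ℝ → ℝ) (f : ℝ → ℝ) (u : ℝ → ℝ) : Prop :=
  MemE u ∧ ∀ x ∈ Set.Ioo (0:ℝ) 1,
    HasDerivAt (fun y => phip p (deriv u y))
      (-(r * a x * f (u x) + α x * phip p (max (u x) 0)
         + β x * phip p (-min (u x) 0))) x

section Compactness

variable {E : Type*} [NormedAddCommGroup E]

/-- Lipschitz functions with a common constant and bounded initial value form a compact set. -/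
lemma isCompact_setOf_lipschitzWith [ProperSpace E] (M : NNReal) (B : ℝ) :
    IsCompact {g : C(ℝ, E) | LipschitzWith M g ∧ ‖g 0‖ ≤ B} := by
  apply ArzelaAscoli.isCompact_of_equicontinuous
  · have himg : ContinuousMap.toFun '' {g : C(ℝ, E) | LipschitzWith M g ∧ ‖g 0‖ ≤ B}
        = {g : ℝ → E | LipschitzWith M g ∧ ‖g 0‖ ≤ B} := by
      ext g
      constructor
      · rintro ⟨h, hh, rfl⟩
        exact hh
      · rintro ⟨h1, h2⟩
        exact ⟨⟨g, h1.continuous⟩, ⟨h1, h2⟩, rfl⟩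
    rw [himg]
    refine IsCompact.of_isClosed_subset
      (isCompact_univ_pi fun x : ℝ => isCompact_closedBall (0 : E) (B + M * |x|)) ?_ ?_
    · simp only [lipschitzWith_iff_dist_le_mul, ofPred_and, ofPred_forall]
      refine IsClosed.inter ?_ ?_
      · refine isClosed_iInter fun x => isClosed_iInter fun y => ?_
        exact isClosed_le (by fun_prop) (by fun_prop)
      · exact isClosed_le (by fun_prop) (by fun_prop)
    · rintro g ⟨h1, h2⟩ x -
      have h3 := h1.dist_le_mul x 0
      rw [mem_closedBall_zero_iff]
      have h4 : ‖g x‖ ≤ ‖g 0‖ + dist (g x) (g 0) := by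
        rw [dist_eq_norm]
        have := norm_add_le (g 0) (g x - g 0)
        simpa using this
      simp only [Real.dist_eq, sub_zero] at h3
      linarith
  · exact (LipschitzWith.uniformEquicontinuous _ M fun g => g.2.1).equicontinuous

lemma exists_subseq_tendsto_of_lipschitzWith [ProperSpace E] (M : NNReal) (B : ℝ) (y : ℕ → ℝ → E)
    (hlip : ∀ n, LipschitzWith M (y n)) (hbd : ∀ n, ‖y n 0‖ ≤ B) :
    ∃ φ : ℕ → ℕ, StrictMono φ ∧ ∃ z : ℝ → E, Continuous z ∧
      ∀ x, Tendsto (fun n => y (φ n) x) atTop (𝓝 (z x)) := by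
  obtain ⟨z, -, φ, hφ, hz⟩ := (isCompact_setOf_lipschitzWith (E := E) M B).tendsto_subseq
    (x := fun n => ⟨y n, (hlip n).continuous⟩) (fun n => ⟨hlip n, hbd n⟩)
  refine ⟨φ, hφ, z, z.continuous, fun x => ?_⟩
  exact ((continuous_eval_const (F := C(ℝ, E)) x).tendsto z).comp hz

variable [NormedSpace ℝ E]

/-- A sequence of approximate solutions of `z' = F x z` subconverges to a solution. -/
lemma exists_subseq_tendsto_solution [ProperSpace E] (F : ℝ → E → E)
    (hF : Continuous (Function.uncurry F))
    (M : NNReal) (B : ℝ) (y : ℕ → ℝ → E)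
    (hlip : ∀ n, LipschitzWith M (y n)) (hbd : ∀ n, ‖y n 0‖ ≤ B)
    (w : ℕ → ℝ → E) (hw : ∀ n, Continuous (w n)) (hwM : ∀ n x, ‖w n x‖ ≤ M)
    (hyw : ∀ x, ∀ᶠ n in atTop, y n x = y n 0 + ∫ t in (0 : ℝ)..x, w n t)
    (s : ℕ → ℝ → ℝ) (hs : ∀ t, Tendsto (fun n => s n t) atTop (𝓝 t))
    (hwF : ∀ t, Tendsto (fun n => w n t - F t (y n (s n t))) atTop (𝓝 0)) :
    ∃ φ : ℕ → ℕ, StrictMono φ ∧ ∃ z : ℝ → E, (∀ x, HasDerivAt z (F x (z x)) x) ∧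
      ∀ x, Tendsto (fun n => y (φ n) x) atTop (𝓝 (z x)) := by
  obtain ⟨φ, hφ, z, hzc, hz⟩ := exists_subseq_tendsto_of_lipschitzWith M B y hlip hbd
  refine ⟨φ, hφ, z, ?_, hz⟩
  have hcont : Continuous fun t => F t (z t) := hF.comp (continuous_id.prodMk hzc)
  have hshift : ∀ t, Tendsto (fun n => y (φ n) (s (φ n) t)) atTop (𝓝 (z t)) := by
    intro t
    have h1 : Tendsto (fun n => y (φ n) (s (φ n) t) - y (φ n) t) atTop (𝓝 0) := by
      have h2 : Tendsto (fun n => (M : ℝ) * dist (s (φ n) t) t) atTop (𝓝 0) := by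
        have := (tendsto_iff_dist_tendsto_zero.1 ((hs t).comp hφ.tendsto_atTop)).const_mul (M : ℝ)
        simpa using this
      refine squeeze_zero_norm (fun n => ?_) h2
      rw [← dist_eq_norm]
      exact (hlip _).dist_le_mul _ _
    simpa using h1.add (hz t)
  have hwt : ∀ t, Tendsto (fun n => w (φ n) t) atTop (𝓝 (F t (z t))) := by
    intro t
    have h1 := (hwF t).comp hφ.tendsto_atTop
    have h2 : Tendsto (fun n => F t (y (φ n) (s (φ n) t))) atTop (𝓝 (F t (z t))) :=
      ((hF.tendsto (t, z t)).comp (tendsto_const_nhds.prodMk_nhds (hshift t)))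
    simpa using h1.add h2
  have hint : ∀ x, z x = z 0 + ∫ t in (0 : ℝ)..x, F t (z t) := by
    intro x
    have h1 : Tendsto (fun n => ∫ t in (0 : ℝ)..x, w (φ n) t) atTop
        (𝓝 (∫ t in (0 : ℝ)..x, F t (z t))) := by
      refine intervalIntegral.tendsto_integral_filter_of_dominated_convergence (fun _ => (M : ℝ))
        ?_ ?_ ?_ ?_
      · exact Eventually.of_forall fun n => (hw _).aestronglyMeasurable
      · exact Eventually.of_forall fun n => Eventually.of_forall fun t _ => hwM _ _
      · exact intervalIntegrable_const
      · exact Eventually.of_forall fun t _ => hwt t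
    refine tendsto_nhds_unique (hz x) (((hz 0).add h1).congr' ?_)
    filter_upwards [hφ.tendsto_atTop.eventually (hyw x)] with n hn
    exact hn.symm
  intro x
  have h1 : HasDerivAt (fun x => z 0 + ∫ t in (0 : ℝ)..x, F t (z t)) (F x (z x)) x :=
    (intervalIntegral.integral_hasDerivAt_right (hcont.intervalIntegrable _ _)
      (hcont.stronglyMeasurableAtFilter _ _) hcont.continuousAt).const_add _
  exact h1.congr_of_eventuallyEq (Eventually.of_forall hint)

lemma lipschitzWith_of_hasDerivAt_bound (M : NNReal) {y y' : ℝ → E}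
    (h : ∀ x, HasDerivAt y (y' x) x) (hM : ∀ x, ‖y' x‖ ≤ M) : LipschitzWith M y :=
  lipschitzWith_of_nnnorm_deriv_le (fun x => (h x).differentiableAt)
    (fun x => by rw [(h x).deriv]; exact_mod_cast hM x)

lemma eq_add_integral_of_hasDerivAt [CompleteSpace E] {y y' : ℝ → E}
    (h : ∀ x, HasDerivAt y (y' x) x) (hc : Continuous y') (x : ℝ) :
    y x = y 0 + ∫ t in (0 : ℝ)..x, y' t := by
  rw [intervalIntegral.integral_eq_sub_of_hasDerivAt (fun t _ => h t) (hc.intervalIntegrable _ _)]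
  simp

/-- Moves a time by `h` towards `0`. -/
def shrinkTime (h t : ℝ) : ℝ := t - max (-h) (min h t)

@[fun_prop]
lemma continuous_shrinkTime (h : ℝ) : Continuous (shrinkTime h) := by
  unfold shrinkTime
  fun_prop

lemma abs_shrinkTime_le {h t b : ℝ} (hh : 0 ≤ h) (hb : 0 ≤ b) (ht : |t| ≤ b + h) :
    |shrinkTime h t| ≤ b := by
  rw [abs_le] at *
  unfold shrinkTime
  rcases le_total h t with h1 | h1
  · rw [min_eq_left h1, max_eq_right (by linarith)]
    constructor <;> linarith
  · rw [min_eq_right h1]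
    rcases le_total (-h) t with h2 | h2
    · rw [max_eq_right h2]
      constructor <;> linarith
    · rw [max_eq_left h2]
      constructor <;> linarith

lemma abs_shrinkTime_sub_le {h : ℝ} (hh : 0 ≤ h) (t : ℝ) : |shrinkTime h t - t| ≤ h := by
  unfold shrinkTime
  rw [abs_le]
  have h1 : max (-h) (min h t) ≤ h := max_le (by linarith) (min_le_left _ _)
  have h2 : -h ≤ max (-h) (min h t) := le_max_left _ _
  constructor <;> linarith

/-- Tonelli iterates for `y' = F x y` with delay `h`. -/
noncomputable def tonelli (F : ℝ → E → E) (h : ℝ) (e : E) : ℕ → ℝ → E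
  | 0 => fun _ => e
  | j + 1 => fun x => e + ∫ t in (0 : ℝ)..x, F t (tonelli F h e j (shrinkTime h t))

lemma continuous_tonelli (F : ℝ → E → E) (hF : Continuous (Function.uncurry F)) (h : ℝ) (j : ℕ) :
    Continuous (fun q : E × ℝ => tonelli F h q.1 j q.2) := by
  induction j with
  | zero => exact continuous_fst
  | succ j ih =>
    simp only [tonelli]
    refine continuous_fst.add ?_
    refine intervalIntegral.continuous_parametric_intervalIntegral_of_continuous
      (f := fun (q : E × ℝ) t => F t (tonelli F h q.1 j (shrinkTime h t))) ?_ continuous_snd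
    have h1 : Continuous fun r : (E × ℝ) × ℝ => tonelli F h r.1.1 j (shrinkTime h r.2) :=
      ih.comp (f := fun r : (E × ℝ) × ℝ => (r.1.1, shrinkTime h r.2)) (by fun_prop)
    exact hF.comp (f := fun r : (E × ℝ) × ℝ => (r.2, tonelli F h r.1.1 j (shrinkTime h r.2)))
      (continuous_snd.prodMk h1)

lemma continuous_tonelli_integrand (F : ℝ → E → E) (hF : Continuous (Function.uncurry F))
    (h : ℝ) (e : E) (j : ℕ) : Continuous fun t => F t (tonelli F h e j (shrinkTime h t)) := by
  have h1 : Continuous fun t => tonelli F h e j (shrinkTime h t) :=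
    (continuous_tonelli F hF h j).comp (f := fun t => (e, shrinkTime h t)) (by fun_prop)
  exact hF.comp (f := fun t => (t, tonelli F h e j (shrinkTime h t))) (continuous_id.prodMk h1)

lemma tonelli_succ_eq (F : ℝ → E → E) {h : ℝ} (hh : 0 ≤ h) (e : E) (j : ℕ) :
    ∀ x, |x| ≤ j * h → tonelli F h e (j + 1) x = tonelli F h e j x := by
  induction j with
  | zero =>
    intro x hx
    have : x = 0 := by simpa using hx
    subst this
    simp [tonelli]
  | succ j ih =>
    intro x hx
    change e + (∫ t in (0 : ℝ)..x, F t (tonelli F h e (j + 1) (shrinkTime h t)))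
      = e + ∫ t in (0 : ℝ)..x, F t (tonelli F h e j (shrinkTime h t))
    refine congrArg (e + ·) ?_
    refine intervalIntegral.integral_congr fun t ht => ?_
    refine congrArg (F t) (ih _ ?_)
    refine abs_shrinkTime_le hh (by positivity) ?_
    have h1 : |t| ≤ |x| := by
      rcases mem_uIcc.1 ht with h2 | h2
      · rw [abs_of_nonneg h2.1, abs_of_nonneg (h2.1.trans h2.2)]; exact h2.2
      · rw [abs_of_nonpos h2.2, abs_of_nonpos (h2.1.trans h2.2)]; linarith [h2.1]
    push_cast at hx
    linarith

/-- The `n`-th Tonelli approximation of the solution of `y' = F x y`, `y 0 = e`. -/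
noncomputable def tonelliApprox (F : ℝ → E → E) (n : ℕ) (e : E) : ℝ → E :=
  tonelli F (1 / ((n : ℝ) + 1)) e ((n + 1) ^ 2 + 1)

lemma tonelliApprox_zero (F : ℝ → E → E) (n : ℕ) (e : E) : tonelliApprox F n e 0 = e := by
  simp [tonelliApprox, tonelli]

lemma exists_subseq_tonelliApprox [ProperSpace E] (F : ℝ → E → E)
    (hF : Continuous (Function.uncurry F))
    (M : NNReal) (hM : ∀ x e, ‖F x e‖ ≤ M) (B : ℝ) (e : ℕ → E) (he : ∀ n, ‖e n‖ ≤ B)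
    (ψ : ℕ → ℕ) (hψ : StrictMono ψ) :
    ∃ φ : ℕ → ℕ, StrictMono φ ∧ ∃ z : ℝ → E, (∀ x, HasDerivAt z (F x (z x)) x) ∧
      ∀ x, Tendsto (fun n => tonelliApprox F (ψ (φ n)) (e (φ n)) x) atTop (𝓝 (z x)) := by
  set h : ℕ → ℝ := fun n => 1 / ((n : ℝ) + 1) with hh
  have hpos : ∀ n, 0 < h n := fun n => Nat.one_div_pos_of_nat
  set w : ℕ → ℝ → E := fun n t =>
    F t (tonelli F (h (ψ n)) (e n) ((ψ n + 1) ^ 2) (shrinkTime (h (ψ n)) t)) with hw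
  have hwc : ∀ n, Continuous (w n) := fun n => continuous_tonelli_integrand F hF _ _ _
  have hy : ∀ n x, tonelliApprox F (ψ n) (e n) x = e n + ∫ t in (0 : ℝ)..x, w n t :=
    fun n x => rfl
  refine exists_subseq_tendsto_solution F hF M B (fun n => tonelliApprox F (ψ n) (e n)) ?_ ?_ w hwc
    (fun n x => hM _ _) ?_ (fun n => shrinkTime (h (ψ n))) ?_ ?_
  · intro n
    refine lipschitzWith_of_hasDerivAt_bound M (y' := w n) (fun x => ?_) (fun x => hM _ _)
    have h1 : HasDerivAt (fun x => e n + ∫ t in (0 : ℝ)..x, w n t) (w n x) x :=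
      (intervalIntegral.integral_hasDerivAt_right ((hwc n).intervalIntegrable _ _)
        ((hwc n).stronglyMeasurableAtFilter _ _) (hwc n).continuousAt).const_add _
    exact h1
  · intro n
    rw [tonelliApprox_zero]
    exact he n
  · intro x
    refine Eventually.of_forall fun n => ?_
    rw [tonelliApprox_zero, hy]
  · intro t
    have h1 : Tendsto (fun n => h (ψ n)) atTop (𝓝 0) :=
      tendsto_one_div_add_atTop_nhds_zero_nat.comp hψ.tendsto_atTop
    rw [tendsto_iff_dist_tendsto_zero]
    refine squeeze_zero (fun _ => dist_nonneg) (fun n => ?_) h1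
    exact abs_shrinkTime_sub_le (hpos _).le t
  · intro t
    refine tendsto_const_nhds.congr' ?_
    obtain ⟨m, hm⟩ := exists_nat_ge |t|
    filter_upwards [eventually_ge_atTop m] with n hn
    have h2 : |shrinkTime (h (ψ n)) t| ≤ ((ψ n + 1) ^ 2 : ℕ) * h (ψ n) := by
      refine abs_shrinkTime_le (hpos _).le (by have := hpos (ψ n); positivity) ?_
      have h3 : (((ψ n + 1) ^ 2 : ℕ) : ℝ) * h (ψ n) = (ψ n : ℝ) + 1 := by
        simp only [hh]
        push_cast
        field_simp
      have h4 : (n : ℝ) ≤ ψ n := by exact_mod_cast hψ.le_apply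
      have h5 : (m : ℝ) ≤ n := by exact_mod_cast hn
      have := hpos (ψ n)
      rw [h3]
      linarith
    have h3 := tonelli_succ_eq F (hpos (ψ n)).le (e n) ((ψ n + 1) ^ 2) _ h2
    simp only [hw]
    rw [eq_comm, sub_eq_zero]
    congr 1
    exact h3.symm

/-- Peano's theorem for bounded continuous fields. -/
lemma exists_global_solution [ProperSpace E] (F : ℝ → E → E) (hF : Continuous (Function.uncurry F))
    (M : NNReal) (hM : ∀ x e, ‖F x e‖ ≤ M) (e : E) :
    ∃ z : ℝ → E, z 0 = e ∧ ∀ x, HasDerivAt z (F x (z x)) x := by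
  obtain ⟨φ, -, z, hz, hlim⟩ := exists_subseq_tonelliApprox F hF M hM ‖e‖ (fun _ => e)
    (fun _ => le_rfl) id strictMono_id
  refine ⟨z, ?_, hz⟩
  have h0 := hlim 0
  simp only [tonelliApprox_zero] at h0
  exact tendsto_nhds_unique h0 tendsto_const_nhds

/-- Shooting without uniqueness: if all solutions starting at `(s₁, 0)` end below `τ` in the second
coordinate and all those starting at `(s₂, 0)` end above `τ`, then some solution ends at `τ`. -/
lemma exists_solution_hitting (F : ℝ → ℝ × ℝ → ℝ × ℝ) (hF : Continuous (Function.uncurry F))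
    (M : NNReal) (hM : ∀ x e, ‖F x e‖ ≤ M) (s₁ s₂ τ : ℝ)
    (h₁ : ∀ z : ℝ → ℝ × ℝ, (∀ x, HasDerivAt z (F x (z x)) x) → z 0 = (s₁, 0) → (z 1).2 < τ)
    (h₂ : ∀ z : ℝ → ℝ × ℝ, (∀ x, HasDerivAt z (F x (z x)) x) → z 0 = (s₂, 0) → τ < (z 1).2) :
    ∃ z : ℝ → ℝ × ℝ, (∀ x, HasDerivAt z (F x (z x)) x) ∧ (z 0).2 = 0 ∧ (z 1).2 = τ := by
  have hev₁ : ∀ᶠ n in atTop, (tonelliApprox F n (s₁, 0) 1).2 < τ := by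
    by_contra hcon
    obtain ⟨ψ, hψ, hψ'⟩ := extraction_of_frequently_atTop (not_eventually.1 hcon)
    obtain ⟨φ, -, z, hz, hlim⟩ := exists_subseq_tonelliApprox F hF M hM ‖((s₁, 0) : ℝ × ℝ)‖
      (fun _ => (s₁, 0)) (fun _ => le_rfl) ψ hψ
    have h0 : z 0 = (s₁, 0) := by
      have h0 := hlim 0
      simp only [tonelliApprox_zero] at h0
      exact tendsto_nhds_unique h0 tendsto_const_nhds
    have h3 := ge_of_tendsto ((continuous_snd.tendsto _).comp (hlim 1))
      (Eventually.of_forall fun n => not_lt.1 (hψ' (φ n)))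
    exact absurd (h₁ z hz h0) (not_lt.2 h3)
  have hev₂ : ∀ᶠ n in atTop, τ < (tonelliApprox F n (s₂, 0) 1).2 := by
    by_contra hcon
    obtain ⟨ψ, hψ, hψ'⟩ := extraction_of_frequently_atTop (not_eventually.1 hcon)
    obtain ⟨φ, -, z, hz, hlim⟩ := exists_subseq_tonelliApprox F hF M hM ‖((s₂, 0) : ℝ × ℝ)‖
      (fun _ => (s₂, 0)) (fun _ => le_rfl) ψ hψ
    have h0 : z 0 = (s₂, 0) := by
      have h0 := hlim 0
      simp only [tonelliApprox_zero] at h0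
      exact tendsto_nhds_unique h0 tendsto_const_nhds
    have h3 := le_of_tendsto ((continuous_snd.tendsto _).comp (hlim 1))
      (Eventually.of_forall fun n => not_lt.1 (hψ' (φ n)))
    exact absurd (h₂ z hz h0) (not_lt.2 h3)
  obtain ⟨N, hN⟩ := eventually_atTop.1 (hev₁.and hev₂)
  have hex : ∀ n, ∃ s ∈ uIcc s₁ s₂, (tonelliApprox F (n + N) (s, 0) 1).2 = τ := by
    intro n
    obtain ⟨ha, hb⟩ := hN (n + N) (by omega)
    have hc : Continuous fun s : ℝ => (tonelliApprox F (n + N) (s, 0) 1).2 :=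
      continuous_snd.comp ((continuous_tonelli F hF _ _).comp
        (f := fun s : ℝ => (((s, 0) : ℝ × ℝ), (1 : ℝ))) (by fun_prop))
    have := intermediate_value_uIcc (a := s₁) (b := s₂) hc.continuousOn
    obtain ⟨s, hs, hs'⟩ := this (mem_uIcc.2 (Or.inl ⟨ha.le, hb.le⟩))
    exact ⟨s, hs, hs'⟩
  choose s hs hsτ using hex
  obtain ⟨φ, -, z, hz, hlim⟩ := exists_subseq_tonelliApprox F hF M hM (max |s₁| |s₂|)
    (fun n => (s n, 0)) (fun n => by
      rw [Prod.norm_def]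
      simp only [Real.norm_eq_abs, abs_zero]
      refine max_le ?_ ((abs_nonneg s₁).trans (le_max_left _ _))
      rcases mem_uIcc.1 (hs n) with h | h
      · exact abs_le_max_abs_abs h.1 h.2
      · rw [max_comm]; exact abs_le_max_abs_abs h.1 h.2) (fun n => n + N)
    (fun a b h => by simpa using h)
  refine ⟨z, hz, ?_, ?_⟩
  · have h0 := (continuous_snd.tendsto _).comp (hlim 0)
    simp only [Function.comp_def, tonelliApprox_zero] at h0
    exact tendsto_nhds_unique h0 tendsto_const_nhds
  · have h1 := (continuous_snd.tendsto _).comp (hlim 1)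
    simp only [Function.comp_def, hsτ] at h1
    exact tendsto_nhds_unique h1 tendsto_const_nhds

end Compactness

section PowerMap

lemma phip_zero (p : ℝ) : phip p 0 = 0 := by simp [phip]

lemma phip_neg (p s : ℝ) : phip p (-s) = -phip p s := by simp [phip]

lemma phip_ne_zero {p s : ℝ} (hs : s ≠ 0) : phip p s ≠ 0 := by
  unfold phip
  have := abs_pos.2 hs
  exact mul_ne_zero (by positivity) hs

lemma abs_phip {p : ℝ} (hp : 1 < p) (s : ℝ) : |phip p s| = |s| ^ (p - 1) := by
  rcases eq_or_ne s 0 with rfl | hs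
  · rw [phip_zero, abs_zero, Real.zero_rpow (by linarith)]
  · unfold phip
    have h := abs_pos.2 hs
    rw [abs_mul, abs_of_nonneg (by positivity : 0 ≤ |s| ^ (p - 2))]
    nth_rw 2 [← Real.rpow_one |s|]
    rw [← Real.rpow_add h]
    ring_nf

lemma mul_phip {p : ℝ} (hp : 1 < p) (s : ℝ) : s * phip p s = |s| ^ p := by
  rcases eq_or_ne s 0 with rfl | hs
  · rw [phip_zero, abs_zero, Real.zero_rpow (by linarith), mul_zero]
  · have h := abs_pos.2 hs
    unfold phip
    have : s * (|s| ^ (p - 2) * s) = |s| ^ (p - 2) * |s| ^ (2 : ℝ) := by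
      rw [Real.rpow_two, sq_abs]
      ring
    rw [this, ← Real.rpow_add h]
    ring_nf

lemma continuous_phip {p : ℝ} (hp : 1 < p) : Continuous (phip p) := by
  rw [continuous_iff_continuousAt]
  intro s
  rcases eq_or_ne s 0 with rfl | hs
  · have h1 : Tendsto (fun s : ℝ => |s| ^ (p - 1)) (𝓝 0) (𝓝 0) := by
      have hc : Continuous fun s : ℝ => |s| ^ (p - 1) :=
        continuous_abs.rpow_const fun _ => Or.inr (by linarith)
      have := hc.tendsto 0
      simpa [Real.zero_rpow (by linarith : p - 1 ≠ 0)] using this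
    rw [ContinuousAt, phip_zero]
    refine squeeze_zero_norm (fun s => ?_) h1
    rw [Real.norm_eq_abs, abs_phip hp]
  · unfold phip
    exact (continuous_abs.continuousAt.rpow_const (Or.inl (abs_ne_zero.2 hs))).mul continuousAt_id

lemma phip_exp_mul (p r s : ℝ) :
    phip p (Real.exp r * s) = Real.exp ((p - 1) * r) * phip p s := by
  unfold phip
  rw [abs_mul, abs_of_pos (Real.exp_pos r), Real.mul_rpow (Real.exp_pos r).le (abs_nonneg s),
    ← Real.exp_mul]
  have : Real.exp ((p - 1) * r) = Real.exp (r * (p - 2)) * Real.exp r := by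
    rw [← Real.exp_add]
    ring_nf
  rw [this]
  ring

lemma phip_phip {p q : ℝ} (hpq : p.HolderConjugate q) (s : ℝ) : phip q (phip p s) = s := by
  rcases eq_or_ne s 0 with rfl | hs
  · simp [phip_zero]
  · have h := abs_pos.2 hs
    have h1 : phip q (phip p s) = |phip p s| ^ (q - 2) * phip p s := rfl
    rw [h1, abs_phip hpq.lt, phip, ← mul_assoc, ← Real.rpow_mul h.le, ← Real.rpow_add h]
    have h2 : (p - 1) * (q - 2) + (p - 2) = 0 := by
      have := hpq.mul_eq_add
      nlinarith
    rw [h2, Real.rpow_zero, one_mul]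

lemma hasDerivAt_abs_rpow_comp {p : ℝ} (hp : 1 < p) {y : ℝ → ℝ} {y' x : ℝ}
    (h : HasDerivAt y y' x) : HasDerivAt (fun t => |y t| ^ p) (p * phip p (y x) * y') x := by
  have h1 := (hasDerivAt_abs_rpow (y x) hp).comp x h
  have h2 : p * |y x| ^ (p - 2) * y x * y' = p * phip p (y x) * y' := by
    unfold phip
    ring
  rw [h2] at h1
  exact h1

end PowerMap

section GeneralizedSine

/-- A generalized sine `S` with its conjugate momentum `T`, normalized to unit energy. -/
structure IsGenSine (p q ν : ℝ) (S T : ℝ → ℝ) : Prop where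
  hasDerivAt_fst : ∀ t, HasDerivAt S (phip q (T t)) t
  hasDerivAt_snd : ∀ t, HasDerivAt T (-phip p (S t)) t
  energy : ∀ t, |S t| ^ p + (p - 1) * |T t| ^ q = 1
  fst_zero : S 0 = 0
  snd_zero : 0 < ν * T 0

lemma exists_isGenSine {p q ν : ℝ} (hpq : p.HolderConjugate q) (hν : ν = 1 ∨ ν = -1) :
    ∃ S T, IsGenSine p q ν S T := by
  have hp := hpq.lt
  have hq := hpq.symm.lt
  have hpq' : (p - 1) * q = p := by
    have := hpq.mul_eq_add
    nlinarith
  have hp1 : 0 < p - 1 := by linarith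
  set En : ℝ × ℝ → ℝ := fun z => |z.1| ^ p + (p - 1) * |z.2| ^ q with hEn
  have hEc : Continuous En := by
    refine ((continuous_abs.comp continuous_fst).rpow_const fun _ => Or.inr (by linarith)).add
      (continuous_const.mul ((continuous_abs.comp continuous_snd).rpow_const
        fun _ => Or.inr (by linarith)))
  set m : ℝ × ℝ → ℝ := fun z => max 1 (En z) with hm
  have hm1 : ∀ z, 1 ≤ m z := fun z => le_max_left _ _
  have hmE : ∀ z, En z ≤ m z := fun z => le_max_right _ _
  set X : ℝ × ℝ → ℝ × ℝ := fun z => (phip q z.2 / m z, -phip p z.1 / m z) with hX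
  have hXc : Continuous X := by
    have hmc : Continuous m := continuous_const.max hEc
    have hm0 : ∀ z, m z ≠ 0 := fun z => (zero_lt_one.trans_le (hm1 z)).ne'
    exact (((continuous_phip hq).comp continuous_snd).div hmc hm0).prodMk
      (((continuous_phip hp).comp continuous_fst).neg.div hmc hm0)
  have hpow : ∀ (r s : ℝ), 1 < r → 0 ≤ s → s ^ (r - 1) ≤ 1 + s ^ r := by
    intro r s hr hs
    rcases le_total s 1 with h | h
    · have h1 : s ^ (r - 1) ≤ 1 := Real.rpow_le_one hs h (by linarith)
      have h2 : 0 ≤ s ^ r := by positivity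
      linarith
    · have h1 : s ^ (r - 1) ≤ s ^ r := Real.rpow_le_rpow_of_exponent_le h (by linarith)
      linarith
  set M : ℝ := 2 + 1 / (p - 1) with hM
  have hMpos : 0 ≤ M := by positivity
  have hXM : ∀ z, ‖X z‖ ≤ M := by
    intro z
    have hmz := hm1 z
    have hmz' := hmE z
    have hmpos : 0 < m z := by linarith
    have hS : 0 ≤ |z.1| ^ p := by positivity
    have hT : 0 ≤ |z.2| ^ q := by positivity
    rw [Prod.norm_def]
    simp only [hX, Real.norm_eq_abs, abs_div, abs_neg, abs_of_pos hmpos, abs_phip hp, abs_phip hq]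
    refine max_le ?_ ?_
    · rw [div_le_iff₀ hmpos]
      have h1 := hpow q |z.2| hq (abs_nonneg _)
      have h2 : |z.2| ^ q ≤ 1 / (p - 1) * m z := by
        rw [div_mul_eq_mul_div, le_div_iff₀ hp1]
        simp only [hEn] at hmz'
        nlinarith
      nlinarith
    · rw [div_le_iff₀ hmpos]
      have h1 := hpow p |z.1| hp (abs_nonneg _)
      have h2 : |z.1| ^ p ≤ m z := by
        simp only [hEn] at hmz'
        nlinarith
      have h3 : 0 ≤ 1 / (p - 1) * m z := by positivity
      nlinarith
  set c : ℝ := (1 / (p - 1)) ^ (1 / q) with hc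
  have hcpos : 0 < c := by positivity
  have hcq : (p - 1) * c ^ q = 1 := by
    rw [hc, ← Real.rpow_mul (by positivity), one_div_mul_cancel (by linarith), Real.rpow_one]
    field_simp
  obtain ⟨z, hz0, hz⟩ := exists_global_solution (fun _ : ℝ => X) (hXc.comp continuous_snd)
    ⟨M, hMpos⟩ (fun _ e => hXM e) ((0 : ℝ), ν * c)
  have hz1 : ∀ x, HasDerivAt (fun t => (z t).1) (phip q (z x).2 / m (z x)) x := fun x => (hz x).fst
  have hz2 : ∀ x, HasDerivAt (fun t => (z t).2) (-phip p (z x).1 / m (z x)) x := fun x => (hz x).snd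
  have hEd : ∀ x, HasDerivAt (fun t => En (z t)) 0 x := by
    intro x
    have h1 := (hasDerivAt_abs_rpow_comp hp (hz1 x)).add
      ((hasDerivAt_abs_rpow_comp hq (hz2 x)).const_mul (p - 1))
    refine h1.congr_deriv ?_
    have : (p - 1) * (q * phip q (z x).2 * (-phip p (z x).1 / m (z x)))
      = ((p - 1) * q) * (phip q (z x).2 * (-phip p (z x).1 / m (z x))) := by ring
    rw [this, hpq']
    ring
  have hE1 : ∀ x, En (z x) = 1 := by
    intro x
    have h1 := is_const_of_deriv_eq_zero (fun x => (hEd x).differentiableAt)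
      (fun x => (hEd x).deriv) x 0
    rw [h1, hz0]
    simp only [hEn, abs_zero, Real.zero_rpow (by linarith : p ≠ 0), abs_mul, abs_of_pos hcpos,
      zero_add]
    have : |ν| = 1 := by rcases hν with rfl | rfl <;> simp
    rw [this, one_mul, hcq]
  have hmz : ∀ x, m (z x) = 1 := fun x => by simp [hm, hE1]
  refine ⟨fun t => (z t).1, fun t => (z t).2, ⟨?_, ?_, hE1, ?_, ?_⟩⟩
  · intro t
    simpa [hmz] using hz1 t
  · intro t
    simpa [hmz] using hz2 t
  · simp [hz0]
  · simp only [hz0]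
    rcases hν with rfl | rfl <;> linarith

end GeneralizedSine

section Polar

variable {p q ν : ℝ} {S T : ℝ → ℝ}

lemma IsGenSine.abs_fst_le (h : IsGenSine p q ν S T) (hp : 1 < p) (t : ℝ) : |S t| ≤ 1 := by
  by_contra hcon
  have h1 := Real.one_lt_rpow (not_le.1 hcon) (by linarith : 0 < p)
  have h2 : 0 ≤ |T t| ^ q := by positivity
  have := h.energy t
  nlinarith

lemma IsGenSine.abs_phip_snd_le (h : IsGenSine p q ν S T) (hpq : p.HolderConjugate q) (t : ℝ) :
    |phip q (T t)| ≤ 1 + 1 / (p - 1) := by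
  have hp1 : 0 < p - 1 := by linarith [hpq.lt]
  have hq := hpq.symm.lt
  rw [abs_phip hq]
  have h0 : 0 ≤ |S t| ^ p := by positivity
  have h1 : |T t| ^ q ≤ 1 / (p - 1) := by
    rw [le_div_iff₀ hp1]
    have := h.energy t
    nlinarith
  have h3 : 0 ≤ 1 / (p - 1) := by positivity
  rcases le_total |T t| 1 with h2 | h2
  · have := Real.rpow_le_one (abs_nonneg (T t)) h2 (by linarith : 0 ≤ q - 1)
    linarith
  · have := Real.rpow_le_rpow_of_exponent_le h2 (by linarith : q - 1 ≤ q)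
    linarith

lemma IsGenSine.continuous_fst (h : IsGenSine p q ν S T) : Continuous S :=
  continuous_iff_continuousAt.2 fun t => (h.hasDerivAt_fst t).continuousAt

lemma IsGenSine.continuous_snd (h : IsGenSine p q ν S T) : Continuous T :=
  continuous_iff_continuousAt.2 fun t => (h.hasDerivAt_snd t).continuousAt

lemma IsGenSine.abs_fst_sub_le (h : IsGenSine p q ν S T) (hpq : p.HolderConjugate q) (t t' : ℝ) :
    |S t - S t'| ≤ (1 + 1 / (p - 1)) * |t - t'| := by
  have := Convex.norm_image_sub_le_of_norm_hasDerivWithin_le (s := univ) (x := t') (y := t)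
    (fun x _ => (h.hasDerivAt_fst x).hasDerivWithinAt)
    (fun x _ => by rw [Real.norm_eq_abs]; exact h.abs_phip_snd_le hpq x) convex_univ
    (mem_univ _) (mem_univ _)
  simpa only [Real.norm_eq_abs] using this

/-- The polar-type coordinates `(ρ, θ) ↦ (e^ρ S(θ), e^{(p-1)ρ} T(θ))`. -/
noncomputable def polarMap (p : ℝ) (S T : ℝ → ℝ) (z : ℝ × ℝ) : ℝ × ℝ :=
  (Real.exp z.1 * S z.2, Real.exp ((p - 1) * z.1) * T z.2)

/-- The derivative of `polarMap`. -/
noncomputable def polarDeriv (p q : ℝ) (S T : ℝ → ℝ) (z : ℝ × ℝ) : ℝ × ℝ →L[ℝ] ℝ × ℝ :=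
  (Real.exp z.1 • (S z.2 • ContinuousLinearMap.fst ℝ ℝ ℝ
    + phip q (T z.2) • ContinuousLinearMap.snd ℝ ℝ ℝ)).prod
  (Real.exp ((p - 1) * z.1) • (((p - 1) * T z.2) • ContinuousLinearMap.fst ℝ ℝ ℝ
    + (-phip p (S z.2)) • ContinuousLinearMap.snd ℝ ℝ ℝ))

lemma polarDeriv_apply (z w : ℝ × ℝ) : polarDeriv p q S T z w =
    (Real.exp z.1 * (S z.2 * w.1 + phip q (T z.2) * w.2),
      Real.exp ((p - 1) * z.1) * ((p - 1) * T z.2 * w.1 - phip p (S z.2) * w.2)) := by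
  refine Prod.ext ?_ ?_ <;> simp [polarDeriv] <;> ring

lemma IsGenSine.energy_phip (h : IsGenSine p q ν S T) (hpq : p.HolderConjugate q) (t : ℝ) :
    S t * phip p (S t) + (p - 1) * (T t * phip q (T t)) = 1 := by
  rw [mul_phip hpq.lt, mul_phip hpq.symm.lt]
  exact h.energy t

lemma IsGenSine.hasStrictFDerivAt_polarMap (h : IsGenSine p q ν S T) (hpq : p.HolderConjugate q)
    (z : ℝ × ℝ) : HasStrictFDerivAt (polarMap p S T) (polarDeriv p q S T z) z := by
  have hS : HasStrictDerivAt S (phip q (T z.2)) z.2 :=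
    hasStrictDerivAt_of_hasDerivAt_of_continuousAt (Eventually.of_forall h.hasDerivAt_fst)
      ((continuous_phip hpq.symm.lt).comp h.continuous_snd).continuousAt
  have hT : HasStrictDerivAt T (-phip p (S z.2)) z.2 :=
    hasStrictDerivAt_of_hasDerivAt_of_continuousAt (Eventually.of_forall h.hasDerivAt_snd)
      ((continuous_phip hpq.lt).comp h.continuous_fst).neg.continuousAt
  have hfst : HasStrictFDerivAt Prod.fst (ContinuousLinearMap.fst ℝ ℝ ℝ) z := hasStrictFDerivAt_fst
  have hsnd : HasStrictFDerivAt Prod.snd (ContinuousLinearMap.snd ℝ ℝ ℝ) z := hasStrictFDerivAt_snd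
  have h1 : HasStrictFDerivAt (fun z : ℝ × ℝ => Real.exp z.1 * S z.2) _ z :=
    ((Real.hasStrictDerivAt_exp z.1).comp_hasStrictFDerivAt z hfst).mul
      (HasStrictDerivAt.comp_hasStrictFDerivAt (f := Prod.snd) z hS hsnd)
  have h2 : HasStrictFDerivAt (fun z : ℝ × ℝ => Real.exp ((p - 1) * z.1) * T z.2) _ z :=
    (HasStrictDerivAt.comp_hasStrictFDerivAt (f := fun y : ℝ × ℝ => (p - 1) * y.1) z
      (Real.hasStrictDerivAt_exp ((p - 1) * z.1)) (hfst.const_mul (p - 1))).mul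
      (HasStrictDerivAt.comp_hasStrictFDerivAt (f := Prod.snd) z hT hsnd)
  refine (h1.prodMk h2).congr_fderiv ?_
  ext <;> simp [polarDeriv] <;> ring

lemma IsGenSine.injective_polarDeriv (h : IsGenSine p q ν S T) (hpq : p.HolderConjugate q)
    (z : ℝ × ℝ) : Function.Injective (polarDeriv p q S T z) := by
  rw [injective_iff_map_eq_zero]
  intro w hw
  rw [polarDeriv_apply, Prod.mk_eq_zero] at hw
  have e1 := (mul_eq_zero.1 hw.1).resolve_left (Real.exp_pos _).ne'
  have e2 := (mul_eq_zero.1 hw.2).resolve_left (Real.exp_pos _).ne'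
  have en := h.energy_phip hpq z.2
  refine Prod.ext ?_ ?_
  · simp only [Prod.fst_zero]
    linear_combination phip p (S z.2) * e1 + phip q (T z.2) * e2 - w.1 * en
  · simp only [Prod.snd_zero]
    linear_combination ((p - 1) * T z.2) * e1 - S z.2 * e2 - w.2 * en

/-- `polarDeriv` as a continuous linear equivalence. -/
lemma IsGenSine.exists_equiv_polarDeriv (h : IsGenSine p q ν S T) (hpq : p.HolderConjugate q)
    (z : ℝ × ℝ) : ∃ L : (ℝ × ℝ) ≃L[ℝ] ℝ × ℝ, (L : ℝ × ℝ →L[ℝ] ℝ × ℝ) = polarDeriv p q S T z :=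
  ⟨(LinearEquiv.ofInjectiveEndo (polarDeriv p q S T z : ℝ × ℝ →ₗ[ℝ] ℝ × ℝ)
    (h.injective_polarDeriv hpq z)).toContinuousLinearEquiv, by ext <;> rfl⟩

/-- The nonlinearity divided by `e^{(p-1)ρ}`, at amplitude `e^ρ` and profile value `s`. -/
noncomputable def scaledNonlin (p : ℝ) (a α β κ : ℝ → ℝ) (x r s : ℝ) : ℝ :=
  a x * κ (Real.exp r * s) * phip p s + α x * phip p (max s 0) + β x * phip p (-min s 0)

/-- The field governing `(ρ, θ)` for the equation
`-(φ_p(u'))' = a κ(u) φ_p(u) + α φ_p(u⁺) + β φ_p(u⁻)`. -/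
noncomputable def polarField (p q : ℝ) (S T a α β κ : ℝ → ℝ) (x : ℝ) (z : ℝ × ℝ) : ℝ × ℝ :=
  (phip q (T z.2) * (phip p (S z.2) - scaledNonlin p a α β κ x z.1 (S z.2)),
    (p - 1) * |T z.2| ^ q + S z.2 * scaledNonlin p a α β κ x z.1 (S z.2))

lemma max_exp_mul (r s : ℝ) : max (Real.exp r * s) 0 = Real.exp r * max s 0 := by
  rw [mul_max_of_nonneg _ _ (Real.exp_pos r).le, mul_zero]

lemma min_exp_mul (r s : ℝ) : min (Real.exp r * s) 0 = Real.exp r * min s 0 := by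
  rw [mul_min_of_nonneg _ _ (Real.exp_pos r).le, mul_zero]

variable {a α β κ : ℝ → ℝ}

lemma exp_mul_scaledNonlin (x r s : ℝ) :
    Real.exp ((p - 1) * r) * scaledNonlin p a α β κ x r s =
      a x * κ (Real.exp r * s) * phip p (Real.exp r * s)
        + α x * phip p (max (Real.exp r * s) 0) + β x * phip p (-min (Real.exp r * s) 0) := by
  rw [max_exp_mul, min_exp_mul, ← mul_neg, phip_exp_mul, phip_exp_mul, phip_exp_mul, scaledNonlin]
  ring

lemma phip_exp_conj (hpq : p.HolderConjugate q) (r t : ℝ) :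
    phip q (Real.exp ((p - 1) * r) * t) = Real.exp r * phip q t := by
  rw [phip_exp_mul]
  have : (q - 1) * ((p - 1) * r) = r := by
    have := hpq.mul_eq_add
    linear_combination r * this
  rw [this]

lemma IsGenSine.polarDeriv_polarField (h : IsGenSine p q ν S T) (hpq : p.HolderConjugate q)
    (x : ℝ) (z : ℝ × ℝ) : polarDeriv p q S T z (polarField p q S T a α β κ x z) =
      (phip q (polarMap p S T z).2,
        -(a x * κ (polarMap p S T z).1 * phip p (polarMap p S T z).1
          + α x * phip p (max (polarMap p S T z).1 0)
          + β x * phip p (-min (polarMap p S T z).1 0))) := by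
  have en := h.energy_phip hpq z.2
  rw [polarDeriv_apply]
  simp only [polarMap]
  rw [← exp_mul_scaledNonlin, phip_exp_conj hpq]
  simp only [polarField]
  rw [← mul_phip hpq.symm.lt (T z.2)]
  refine Prod.ext ?_ ?_
  · simp only
    linear_combination Real.exp z.1 * phip q (T z.2) * en
  · simp only
    linear_combination (- Real.exp ((p - 1) * z.1) * scaledNonlin p a α β κ x z.1 (S z.2)) * en

/-- A trajectory of the polar field yields a solution of the second order equation. -/
lemma IsGenSine.hasDerivAt_polarMap (h : IsGenSine p q ν S T) (hpq : p.HolderConjugate q)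
    {z : ℝ → ℝ × ℝ} {x : ℝ} (hz : HasDerivAt z (polarField p q S T a α β κ x (z x)) x) :
    HasDerivAt (fun t => polarMap p S T (z t))
      (phip q (polarMap p S T (z x)).2,
        -(a x * κ (polarMap p S T (z x)).1 * phip p (polarMap p S T (z x)).1
          + α x * phip p (max (polarMap p S T (z x)).1 0)
          + β x * phip p (-min (polarMap p S T (z x)).1 0))) x := by
  have h1 := (h.hasStrictFDerivAt_polarMap hpq (z x)).hasFDerivAt.comp_hasDerivAt x hz
  rw [h.polarDeriv_polarField hpq] at h1
  exact h1

lemma IsGenSine.continuous_polarField (h : IsGenSine p q ν S T) (hpq : p.HolderConjugate q)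
    (ha : Continuous a) (hα : Continuous α) (hβ : Continuous β) (hκ : Continuous κ) :
    Continuous (Function.uncurry (polarField p q S T a α β κ)) := by
  have hS := h.continuous_fst
  have hT := h.continuous_snd
  have hp' := continuous_phip hpq.lt
  have hq' := continuous_phip hpq.symm.lt
  have hTq : Continuous fun e : ℝ × ℝ × ℝ => |T e.2.2| ^ q :=
    (by fun_prop : Continuous fun e : ℝ × ℝ × ℝ => |T e.2.2|).rpow_const
      fun _ => Or.inr (by linarith [hpq.symm.lt])
  unfold Function.uncurry polarField scaledNonlin
  fun_prop

/-- Uniform bounds on the coefficients. -/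
structure CoeffBound (C : ℝ) (a α β κ : ℝ → ℝ) : Prop where
  mul_le : ∀ x s, |a x * κ s| ≤ C
  pos_le : ∀ x, |α x| ≤ C
  neg_le : ∀ x, |β x| ≤ C

lemma CoeffBound.nonneg {C : ℝ} (h : CoeffBound C a α β κ) : 0 ≤ C :=
  (abs_nonneg _).trans (h.pos_le 0)

lemma abs_phip_le_one (hp : 1 < p) {s : ℝ} (hs : |s| ≤ 1) : |phip p s| ≤ 1 := by
  rw [abs_phip hp]
  exact Real.rpow_le_one (abs_nonneg _) hs (by linarith)

lemma abs_max_zero_le (s : ℝ) : |max s 0| ≤ |s| := by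
  simpa using abs_max_sub_max_le_abs s 0 0

lemma abs_min_zero_le (s : ℝ) : |min s 0| ≤ |s| := by
  simpa using abs_min_sub_min_le_max s 0 0 0

lemma CoeffBound.abs_scaledNonlin_le {C : ℝ} (h : CoeffBound C a α β κ) (hp : 1 < p)
    (x r : ℝ) {s : ℝ} (hs : |s| ≤ 1) : |scaledNonlin p a α β κ x r s| ≤ 3 * C := by
  have hC := h.nonneg
  have key : ∀ c t : ℝ, |c| ≤ C → |t| ≤ 1 → |c * phip p t| ≤ C := by
    intro c t hc ht
    rw [abs_mul]
    calc |c| * |phip p t| ≤ C * 1 :=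
          mul_le_mul hc (abs_phip_le_one hp ht) (abs_nonneg _) hC
      _ = C := mul_one C
  have h1 := key _ _ (h.mul_le x (Real.exp r * s)) hs
  have h2 := key _ _ (h.pos_le x) ((abs_max_zero_le s).trans hs)
  have h3 := key _ (-min s 0) (h.neg_le x) (by rw [abs_neg]; exact (abs_min_zero_le s).trans hs)
  unfold scaledNonlin
  refine (abs_add_le _ _).trans ?_
  have := abs_add_le (a x * κ (Real.exp r * s) * phip p s) (α x * phip p (max s 0))
  linarith

/-- The bound on the polar field provided by a `CoeffBound`. -/
noncomputable def fieldBound (p C : ℝ) : ℝ := (1 + 1 / (p - 1)) * (1 + 3 * C)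

lemma fieldBound_nonneg {C : ℝ} (hp : 1 < p) (hC : 0 ≤ C) : 0 ≤ fieldBound p C := by
  have : 0 < p - 1 := by linarith
  unfold fieldBound
  positivity

lemma IsGenSine.norm_polarField_le (h : IsGenSine p q ν S T) (hpq : p.HolderConjugate q) {C : ℝ}
    (hC : CoeffBound C a α β κ) (x : ℝ) (z : ℝ × ℝ) :
    ‖polarField p q S T a α β κ x z‖ ≤ fieldBound p C := by
  have hp := hpq.lt
  have hp1 : 0 < p - 1 := by linarith
  have hS := h.abs_fst_le hp z.2
  have hN := hC.abs_scaledNonlin_le hp x z.1 hS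
  have hC0 := hC.nonneg
  have h1 : 0 ≤ 1 / (p - 1) := by positivity
  rw [Prod.norm_def]
  simp only [polarField, Real.norm_eq_abs, fieldBound]
  refine max_le ?_ ?_
  · rw [abs_mul]
    refine mul_le_mul (h.abs_phip_snd_le hpq _) ?_ (abs_nonneg _) (by positivity)
    refine (abs_sub _ _).trans ?_
    linarith [abs_phip_le_one hp hS]
  · have h2 : (p - 1) * |T z.2| ^ q = 1 - |S z.2| ^ p := by linarith [h.energy z.2]
    have h3 : 0 ≤ |S z.2| ^ p := by positivity
    have h4 : |S z.2| ^ p ≤ 1 := Real.rpow_le_one (abs_nonneg _) hS (by linarith)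
    refine (abs_add_le _ _).trans ?_
    rw [h2, abs_of_nonneg (by linarith : 0 ≤ 1 - |S z.2| ^ p), abs_mul]
    have h5 : |S z.2| * |scaledNonlin p a α β κ x z.1 (S z.2)| ≤ 1 * (3 * C) :=
      mul_le_mul hS hN (abs_nonneg _) zero_le_one
    have h6 : 0 ≤ 1 / (p - 1) * (1 + 3 * C) := by positivity
    linarith

/-- The angular velocity for constant `κ = μ`. -/
noncomputable def angularSpeed (p : ℝ) (S a α β : ℝ → ℝ) (μ x t : ℝ) : ℝ :=
  1 + (a x * μ - 1) * |S t| ^ p + α x * |max (S t) 0| ^ p - β x * |min (S t) 0| ^ p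

lemma mul_phip_max (hp : 1 < p) (s : ℝ) : s * phip p (max s 0) = |max s 0| ^ p := by
  rw [← mul_phip hp]
  rcases le_total s 0 with h | h
  · simp [max_eq_right h, phip_zero]
  · simp [max_eq_left h]

lemma mul_phip_min (hp : 1 < p) (s : ℝ) : s * phip p (-min s 0) = -|min s 0| ^ p := by
  rw [← mul_phip hp, phip_neg]
  rcases le_total s 0 with h | h
  · simp [min_eq_left h]
  · simp [min_eq_right h, phip_zero]

lemma IsGenSine.polarField_snd (h : IsGenSine p q ν S T) (hpq : p.HolderConjugate q)
    (μ x : ℝ) (z : ℝ × ℝ) : (polarField p q S T a α β κ x z).2 =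
      angularSpeed p S a α β μ x z.2
        + a x * ((κ (Real.exp z.1 * S z.2) - μ) * |S z.2| ^ p) := by
  have h1 := mul_phip hpq.lt (S z.2)
  have h2 := mul_phip_max hpq.lt (S z.2)
  have h3 := mul_phip_min hpq.lt (S z.2)
  have h4 := h.energy z.2
  simp only [polarField, angularSpeed, scaledNonlin]
  linear_combination h4 + a x * κ (Real.exp z.1 * S z.2) * h1 + α x * h2 + β x * h3

lemma abs_abs_rpow_sub_le (hp : 1 < p) {s t : ℝ} (hs : |s| ≤ 1) (ht : |t| ≤ 1) :
    |(|s| ^ p - |t| ^ p)| ≤ p * |s - t| := by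
  have := Convex.norm_image_sub_le_of_norm_hasDerivWithin_le (s := Icc (-1 : ℝ) 1) (x := t) (y := s)
    (f := fun x : ℝ => |x| ^ p) (f' := fun x => p * phip p x) (C := p)
    (fun x _ => by
      have := hasDerivAt_abs_rpow_comp hp (hasDerivAt_id x)
      simpa using this.hasDerivWithinAt)
    (fun x hx => by
      rw [Real.norm_eq_abs, abs_mul, abs_of_pos (by linarith : 0 < p)]
      have := abs_phip_le_one hp (abs_le.2 hx)
      nlinarith) (convex_Icc _ _) (abs_le.1 ht) (abs_le.1 hs)
  simpa only [Real.norm_eq_abs] using this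

lemma IsGenSine.abs_angularSpeed_sub_le (h : IsGenSine p q ν S T) (hpq : p.HolderConjugate q)
    {C μ : ℝ} (hC : CoeffBound C a α β (fun _ => μ)) (x t t' : ℝ) :
    |angularSpeed p S a α β μ x t - angularSpeed p S a α β μ x t'|
      ≤ (1 + 3 * C) * (p * (1 + 1 / (p - 1))) * |t - t'| := by
  have hp := hpq.lt
  have hC0 := hC.nonneg
  have hl := h.abs_fst_sub_le hpq t t'
  set D := (1 + 1 / (p - 1)) * |t - t'| with hD
  have hs := h.abs_fst_le hp t
  have ht := h.abs_fst_le hp t'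
  have b1 : |(|S t| ^ p - |S t'| ^ p)| ≤ p * D :=
    (abs_abs_rpow_sub_le hp hs ht).trans (by gcongr)
  have b2 : |(|max (S t) 0| ^ p - |max (S t') 0| ^ p)| ≤ p * D := by
    refine (abs_abs_rpow_sub_le hp ((abs_max_zero_le _).trans hs)
      ((abs_max_zero_le _).trans ht)).trans ?_
    gcongr
    exact (abs_max_sub_max_le_abs _ _ _).trans hl
  have b3 : |(|min (S t) 0| ^ p - |min (S t') 0| ^ p)| ≤ p * D := by
    refine (abs_abs_rpow_sub_le hp ((abs_min_zero_le _).trans hs)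
      ((abs_min_zero_le _).trans ht)).trans ?_
    gcongr
    refine (abs_min_sub_min_le_max _ _ _ _).trans ?_
    simpa using hl
  have key : ∀ c w B : ℝ, |c| ≤ B → |w| ≤ p * D → |c * w| ≤ B * (p * D) := by
    intro c w B hc hw
    rw [abs_mul]
    exact mul_le_mul hc hw (abs_nonneg _) ((abs_nonneg _).trans hc)
  have c1 : |a x * μ - 1| ≤ C + 1 := by
    refine (abs_sub _ _).trans ?_
    have := hC.mul_le x 0
    simp only [abs_one]
    linarith
  have k1 := key _ _ _ c1 b1
  have k2 := key _ _ _ (hC.pos_le x) b2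
  have k3 := key _ _ _ (hC.neg_le x) b3
  have e : angularSpeed p S a α β μ x t - angularSpeed p S a α β μ x t'
      = (a x * μ - 1) * (|S t| ^ p - |S t'| ^ p)
        + α x * (|max (S t) 0| ^ p - |max (S t') 0| ^ p)
        - β x * (|min (S t) 0| ^ p - |min (S t') 0| ^ p) := by
    unfold angularSpeed
    ring
  rw [e]
  refine (abs_sub _ _).trans ?_
  have := abs_add_le ((a x * μ - 1) * (|S t| ^ p - |S t'| ^ p))
    (α x * (|max (S t) 0| ^ p - |max (S t') 0| ^ p))
  have e2 : (1 + 3 * C) * (p * (1 + 1 / (p - 1))) * |t - t'|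
    = (C + 1) * (p * D) + C * (p * D) + C * (p * D) := by
    rw [hD]
    ring
  linarith

end Polar

section Comparison

/-- A differential inequality `D' ≥ -K|D|` preserves nonnegativity. -/
lemma nonneg_of_neg_mul_abs_le_deriv {D D' : ℝ → ℝ} {b c K : ℝ} (hc : ContinuousOn D (Icc b c))
    (hd : ∀ x ∈ Ioo b c, HasDerivAt D (D' x) x) (hK : ∀ x ∈ Ioo b c, -(K * |D x|) ≤ D' x)
    (h0 : 0 ≤ D b) : ∀ x ∈ Icc b c, 0 ≤ D x := by
  intro x hx
  by_contra! hneg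
  set s := {t ∈ Icc b x | 0 ≤ D t} with hs
  have hsub : Icc b x ⊆ Icc b c := Icc_subset_Icc_right hx.2
  have hsc : IsCompact s := by
    have : s = Icc b x ∩ D ⁻¹' Ici 0 := rfl
    exact isCompact_Icc.of_isClosed_subset
      (this ▸ (hc.mono hsub).preimage_isClosed_of_isClosed isClosed_Icc isClosed_Ici)
      fun t ht => ht.1
  obtain ⟨t, ht, hmax⟩ := hsc.exists_isGreatest ⟨b, ⟨le_rfl, hx.1⟩, h0⟩
  have htx : t < x := lt_of_le_of_ne ht.1.2 fun h => by
    have := ht.2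
    rw [h] at this
    linarith
  have hlt : ∀ y ∈ Ioc t x, D y < 0 := by
    intro y hy
    by_contra! h
    exact (hmax ⟨⟨ht.1.1.trans hy.1.le, hy.2⟩, h⟩).not_gt hy.1
  have hmono : MonotoneOn (fun y => Real.exp (-K * y) * D y) (Icc t x) := by
    refine monotoneOn_of_hasDerivWithinAt_nonneg (convex_Icc t x)
      (f' := fun y => Real.exp (-K * y) * (-K) * D y + Real.exp (-K * y) * D' y) ?_ ?_ ?_
    · exact (by fun_prop : Continuous fun y => Real.exp (-K * y)).continuousOn.mul
        (hc.mono ((Icc_subset_Icc_left ht.1.1).trans hsub))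
    · intro y hy
      rw [interior_Icc] at hy
      have h1 := hd y ⟨ht.1.1.trans_lt hy.1, hy.2.trans_le hx.2⟩
      have h2 : HasDerivAt (fun y => Real.exp (-K * y)) (Real.exp (-K * y) * (-K)) y := by
        simpa using ((hasDerivAt_id y).const_mul (-K)).exp
      exact (h2.mul h1).hasDerivWithinAt
    · intro y hy
      rw [interior_Icc] at hy
      have h1 := hK y ⟨ht.1.1.trans_lt hy.1, hy.2.trans_le hx.2⟩
      rw [abs_of_neg (hlt y ⟨hy.1, hy.2.le⟩)] at h1
      have h2 := Real.exp_pos (-K * y)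
      have : 0 ≤ Real.exp (-K * y) * (D' y - K * D y) := mul_nonneg h2.le (by linarith)
      linarith
  have h1 := hmono ⟨le_rfl, htx.le⟩ ⟨htx.le, le_rfl⟩ htx.le
  have h2 : 0 ≤ Real.exp (-K * t) * D t := mul_nonneg (Real.exp_pos _).le ht.2
  have h3 : Real.exp (-K * x) * D x < 0 := mul_neg_of_pos_of_neg (Real.exp_pos _) hneg
  simp only at h1
  linarith

/-- A nonnegative function with `D' ≥ -K D` that vanishes at the right end vanishes. -/
lemma eq_zero_of_neg_mul_le_deriv {D D' : ℝ → ℝ} {b c K : ℝ} (hc : ContinuousOn D (Icc b c))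
    (hd : ∀ x ∈ Ioo b c, HasDerivAt D (D' x) x) (hK : ∀ x ∈ Ioo b c, -(K * D x) ≤ D' x)
    (hnn : ∀ x ∈ Icc b c, 0 ≤ D x) (h1 : D c ≤ 0) : ∀ x ∈ Icc b c, D x = 0 := by
  intro x hx
  have hmono : MonotoneOn (fun y => Real.exp (K * y) * D y) (Icc b c) := by
    refine monotoneOn_of_hasDerivWithinAt_nonneg (convex_Icc b c)
      (f' := fun y => Real.exp (K * y) * K * D y + Real.exp (K * y) * D' y) ?_ ?_ ?_
    · exact (by fun_prop : Continuous fun y => Real.exp (K * y)).continuousOn.mul hc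
    · intro y hy
      rw [interior_Icc] at hy
      have h2 : HasDerivAt (fun y => Real.exp (K * y)) (Real.exp (K * y) * K) y := by
        simpa using ((hasDerivAt_id y).const_mul K).exp
      exact (h2.mul (hd y hy)).hasDerivWithinAt
    · intro y hy
      rw [interior_Icc] at hy
      have : 0 ≤ Real.exp (K * y) * (D' y + K * D y) :=
        mul_nonneg (Real.exp_pos _).le (by linarith [hK y hy])
      linarith
  have h2 := hmono hx ⟨hx.1.trans hx.2, le_rfl⟩ hx.2
  have h3 : Real.exp (K * c) * D c ≤ 0 := mul_nonpos_of_nonneg_of_nonpos (Real.exp_pos _).le h1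
  simp only at h2
  refine le_antisymm ?_ (hnn x hx)
  by_contra! h4
  have := mul_pos (Real.exp_pos (K * x)) h4
  linarith

variable {p q ν : ℝ} {S T a α β : ℝ → ℝ}

lemma angularSpeed_of_fst_eq_zero (hp : 1 < p) {t : ℝ} (ht : S t = 0) (μ x : ℝ) :
    angularSpeed p S a α β μ x t = 1 := by
  have : (0 : ℝ) ^ p = 0 := Real.zero_rpow (by linarith)
  simp [angularSpeed, ht, this]

lemma angularSpeed_sub (μ₁ μ₂ x t : ℝ) :
    angularSpeed p S a α β μ₂ x t - angularSpeed p S a α β μ₁ x t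
      = a x * (μ₂ - μ₁) * |S t| ^ p := by
  unfold angularSpeed
  ring

lemma IsGenSine.snd_ne_zero (h : IsGenSine p q ν S T) (hpq : p.HolderConjugate q) {t : ℝ}
    (ht : S t = 0) : T t ≠ 0 := by
  intro h0
  have := h.energy_phip hpq t
  rw [ht, h0] at this
  simp at this

lemma IsGenSine.angle_le (h : IsGenSine p q ν S T) (hpq : p.HolderConjugate q) {C μ₁ μ₂ : ℝ}
    (hC : CoeffBound C a α β (fun _ => μ₁)) (ha : ∀ x, 0 < a x) (hμ : μ₁ ≤ μ₂) {b c : ℝ}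
    {θ₁ θ₂ : ℝ → ℝ} (hc₁ : ContinuousOn θ₁ (Icc b c)) (hc₂ : ContinuousOn θ₂ (Icc b c))
    (h₁ : ∀ x ∈ Ioo b c, HasDerivAt θ₁ (angularSpeed p S a α β μ₁ x (θ₁ x)) x)
    (h₂ : ∀ x ∈ Ioo b c, HasDerivAt θ₂ (angularSpeed p S a α β μ₂ x (θ₂ x)) x)
    (h0 : θ₁ b ≤ θ₂ b) : ∀ x ∈ Icc b c, θ₁ x ≤ θ₂ x := by
  intro x hx
  refine sub_nonneg.1 (nonneg_of_neg_mul_abs_le_deriv (D := fun x => θ₂ x - θ₁ x)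
    (K := (1 + 3 * C) * (p * (1 + 1 / (p - 1)))) (hc₂.sub hc₁)
    (fun y hy => (h₂ y hy).sub (h₁ y hy)) ?_ (sub_nonneg.2 h0) x hx)
  intro y _
  have h3 := abs_le.1 (h.abs_angularSpeed_sub_le hpq hC y (θ₂ y) (θ₁ y))
  have h4 := angularSpeed_sub (p := p) (S := S) (a := a) (α := α) (β := β) μ₁ μ₂ y (θ₂ y)
  have h5 : 0 ≤ a y * (μ₂ - μ₁) * |S (θ₂ y)| ^ p :=
    mul_nonneg (mul_nonneg (ha y).le (by linarith)) (by positivity)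
  linarith [h3.1]

lemma IsGenSine.angle_lt (h : IsGenSine p q ν S T) (hpq : p.HolderConjugate q) {C μ₁ μ₂ : ℝ}
    (hC : CoeffBound C a α β (fun _ => μ₁)) (ha : ∀ x, 0 < a x) (hμ : μ₁ < μ₂)
    {θ₁ θ₂ : ℝ → ℝ} {b c : ℝ} (hbc : b < c)
    (h₁ : ∀ x, HasDerivAt θ₁ (angularSpeed p S a α β μ₁ x (θ₁ x)) x)
    (h₂ : ∀ x, HasDerivAt θ₂ (angularSpeed p S a α β μ₂ x (θ₂ x)) x)
    (h0 : θ₁ b ≤ θ₂ b) : θ₁ c < θ₂ c := by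
  by_contra! hcon
  have hc₁ : Continuous θ₁ := continuous_iff_continuousAt.2 fun x => (h₁ x).continuousAt
  have hc₂ : Continuous θ₂ := continuous_iff_continuousAt.2 fun x => (h₂ x).continuousAt
  have hle := h.angle_le hpq hC ha hμ.le hc₁.continuousOn hc₂.continuousOn (b := b) (c := c)
    (fun x _ => h₁ x) (fun x _ => h₂ x) h0
  have key : ∀ y, 0 ≤ a y * (μ₂ - μ₁) * |S (θ₂ y)| ^ p := fun y =>
    mul_nonneg (mul_nonneg (ha y).le (by linarith)) (by positivity)
  have hsub : ∀ y, angularSpeed p S a α β μ₂ y (θ₂ y) - angularSpeed p S a α β μ₁ y (θ₂ y)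
      = a y * (μ₂ - μ₁) * |S (θ₂ y)| ^ p := fun y => angularSpeed_sub μ₁ μ₂ y (θ₂ y)
  have hD : ∀ x ∈ Icc b c, θ₂ x - θ₁ x = 0 := by
    refine eq_zero_of_neg_mul_le_deriv (K := (1 + 3 * C) * (p * (1 + 1 / (p - 1))))
      (hc₂.sub hc₁).continuousOn (fun y _ => (h₂ y).sub (h₁ y)) ?_
      (fun x hx => sub_nonneg.2 (hle x hx)) (by linarith)
    intro y hy
    have h3 := abs_le.1 (h.abs_angularSpeed_sub_le hpq hC y (θ₂ y) (θ₁ y))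
    rw [abs_of_nonneg (sub_nonneg.2 (hle y (Ioo_subset_Icc_self hy)))] at h3
    linarith [h3.1, hsub y, key y]
  have hS : ∀ y ∈ Ioo b c, S (θ₂ y) = 0 := by
    intro y hy
    have hev : (fun x => θ₂ x - θ₁ x) =ᶠ[𝓝 y] fun _ => 0 :=
      eventually_of_mem (Ioo_mem_nhds hy.1 hy.2) fun x hx => hD x (Ioo_subset_Icc_self hx)
    have hder := (((h₂ y).sub (h₁ y)).congr_of_eventuallyEq
      (f₁ := fun _ => 0) hev.symm).unique (hasDerivAt_const y (0 : ℝ))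
    have he : θ₁ y = θ₂ y := by linarith [hD y (Ioo_subset_Icc_self hy)]
    rw [he, hsub y] at hder
    have h6 := (mul_eq_zero.1 hder).resolve_left (mul_pos (ha y) (by linarith)).ne'
    rw [Real.rpow_eq_zero (abs_nonneg _) (by linarith [hpq.lt])] at h6
    exact abs_eq_zero.1 h6
  obtain ⟨y, hy⟩ := nonempty_Ioo.2 hbc
  have hder := (h.hasDerivAt_fst (θ₂ y)).comp y (h₂ y)
  have hev : (S ∘ θ₂) =ᶠ[𝓝 y] fun _ => 0 :=
    eventually_of_mem (Ioo_mem_nhds hy.1 hy.2) fun x hx => hS x hx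
  have h7 := (hder.congr_of_eventuallyEq hev.symm).unique (hasDerivAt_const y (0 : ℝ))
  rw [angularSpeed_of_fst_eq_zero hpq.lt (hS y hy), mul_one] at h7
  exact phip_ne_zero (h.snd_ne_zero hpq (hS y hy)) h7

end Comparison

section Asymptotics

variable {p q ν : ℝ} {S T a α β κ : ℝ → ℝ}

lemma eventually_atBot_abs_sub_mul_rpow_lt (hp : 1 < p) {μ : ℝ} (hκ : Continuous κ)
    (h0 : κ 0 = μ) {ε : ℝ} (hε : 0 < ε) :
    ∀ᶠ r in atBot, ∀ s, |s| ≤ 1 → |(κ (Real.exp r * s) - μ) * |s| ^ p| < ε := by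
  have h1 := Metric.tendsto_nhds_nhds.1 (hκ.tendsto 0) ε hε
  obtain ⟨δ, hδ, h1⟩ := h1
  filter_upwards [Real.tendsto_exp_atBot.eventually (gt_mem_nhds hδ)] with r hr s hs
  have h2 : |κ (Real.exp r * s) - μ| < ε := by
    have := @h1 (Real.exp r * s) (by
      rw [dist_zero_right, Real.norm_eq_abs, abs_mul, abs_of_pos (Real.exp_pos r)]
      nlinarith [Real.exp_pos r, abs_nonneg s])
    rwa [h0, Real.dist_eq] at this
  have h3 := Real.rpow_le_one (abs_nonneg s) hs (by linarith : 0 ≤ p)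
  have h4 : 0 ≤ |s| ^ p := by positivity
  rw [abs_mul, abs_of_nonneg h4]
  nlinarith [abs_nonneg (κ (Real.exp r * s) - μ)]

lemma eventually_atTop_abs_sub_mul_rpow_lt (hp : 1 < p) {μ B : ℝ}
    (hκ : Tendsto κ (atBot ⊔ atTop) (𝓝 μ)) (hB : ∀ s, |κ s| ≤ B) {ε : ℝ} (hε : 0 < ε) :
    ∀ᶠ r in atTop, ∀ s, |s| ≤ 1 → |(κ (Real.exp r * s) - μ) * |s| ^ p| < ε := by
  have hp0 : 0 < p := by linarith
  obtain ⟨η, hη, h1⟩ : ∃ η > 0, ∀ s : ℝ, |s| < η → (B + |μ|) * |s| ^ p < ε := by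
    have hc : Continuous fun s : ℝ => (B + |μ|) * |s| ^ p :=
      continuous_const.mul (continuous_abs.rpow_const fun _ => Or.inr hp0.le)
    have h2 := hc.tendsto 0
    simp only [abs_zero, Real.zero_rpow hp0.ne', mul_zero] at h2
    obtain ⟨η, hη, h3⟩ := Metric.eventually_nhds_iff.1 (h2.eventually (gt_mem_nhds hε))
    exact ⟨η, hη, fun s hs => h3 (by simpa using hs)⟩
  have h2 : ∀ᶠ s in atBot ⊔ atTop, |κ s - μ| < ε := by
    have := Metric.tendsto_nhds.1 hκ ε hε
    simpa only [Real.dist_eq] using this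
  rw [eventually_sup] at h2
  obtain ⟨N₁, hN₁⟩ := eventually_atBot.1 h2.1
  obtain ⟨N₂, hN₂⟩ := eventually_atTop.1 h2.2
  have hN : ∀ s, max (-N₁) N₂ ≤ |s| → |κ s - μ| < ε := by
    intro s hs
    rcases le_total 0 s with h | h
    · rw [abs_of_nonneg h] at hs
      exact hN₂ s ((le_max_right _ _).trans hs)
    · rw [abs_of_nonpos h] at hs
      exact hN₁ s (by linarith [(le_max_left _ _).trans hs])
  filter_upwards [Real.tendsto_exp_atTop.eventually_ge_atTop (max (-N₁) N₂ / η)] with r hr s hs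
  have h4 : 0 ≤ |s| ^ p := by positivity
  rw [abs_mul, abs_of_nonneg h4]
  rcases lt_or_ge |s| η with h | h
  · refine lt_of_le_of_lt (mul_le_mul_of_nonneg_right ?_ h4) (h1 s h)
    exact (abs_sub _ _).trans (by gcongr; exact hB _)
  · have h5 : |κ (Real.exp r * s) - μ| < ε := by
      refine hN _ ?_
      rw [abs_mul, abs_of_pos (Real.exp_pos r)]
      rw [div_le_iff₀ hη] at hr
      exact hr.trans (by gcongr)
    have h3 := Real.rpow_le_one (abs_nonneg s) hs hp0.le
    nlinarith [abs_nonneg (κ (Real.exp r * s) - μ)]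

lemma IsGenSine.continuous_angularSpeed (h : IsGenSine p q ν S T) (hp : 1 < p)
    (ha : Continuous a) (hα : Continuous α) (hβ : Continuous β) (μ : ℝ) :
    Continuous (Function.uncurry (angularSpeed p S a α β μ)) := by
  have hS := h.continuous_fst
  have hpow : Continuous fun s : ℝ => |s| ^ p :=
    continuous_abs.rpow_const fun _ => Or.inr (by linarith)
  have h1 : Continuous fun e : ℝ × ℝ => |S e.2| ^ p := hpow.comp (by fun_prop)
  have h2 : Continuous fun e : ℝ × ℝ => |max (S e.2) 0| ^ p := hpow.comp (by fun_prop)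
  have h3 : Continuous fun e : ℝ × ℝ => |min (S e.2) 0| ^ p := hpow.comp (by fun_prop)
  unfold Function.uncurry angularSpeed
  fun_prop

lemma tendsto_of_abs_sub_le {l : Filter ℝ} (hl : l = atBot ∨ l = atTop) {R ρ : ℕ → ℝ} {B : ℝ}
    (hR : Tendsto R atTop l) (h : ∀ n, |ρ n - R n| ≤ B) : Tendsto ρ atTop l := by
  rcases hl with rfl | rfl
  · exact tendsto_atBot_mono (fun n => by linarith [(abs_le.1 (h n)).2])
      (tendsto_atBot_add_const_right _ B hR)
  · exact tendsto_atTop_mono (fun n => by linarith [(abs_le.1 (h n)).1])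
      (tendsto_atTop_add_const_right _ (-B) hR)

/-- Angles of trajectories with amplitude tending to `0` or `∞` accumulate at a trajectory of the
limiting half-linear problem. -/
lemma IsGenSine.exists_subseq_tendsto_angle (h : IsGenSine p q ν S T) (hpq : p.HolderConjugate q)
    (ha : Continuous a) (hα : Continuous α) (hβ : Continuous β) (hκ : Continuous κ) {C μ : ℝ}
    (hC : CoeffBound C a α β κ) {l : Filter ℝ} (hl : l = atBot ∨ l = atTop)
    (hlim : ∀ ε > 0, ∀ᶠ r in l, ∀ s, |s| ≤ 1 → |(κ (Real.exp r * s) - μ) * |s| ^ p| < ε)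
    {R : ℕ → ℝ} (hR : Tendsto R atTop l) {z : ℕ → ℝ → ℝ × ℝ} (hz0 : ∀ n, z n 0 = (R n, 0))
    (hz : ∀ n x, HasDerivAt (z n) (polarField p q S T a α β κ x (z n x)) x) :
    ∃ φ : ℕ → ℕ, StrictMono φ ∧ ∃ θ : ℝ → ℝ, θ 0 = 0 ∧
      (∀ x, HasDerivAt θ (angularSpeed p S a α β μ x (θ x)) x) ∧
      Tendsto (fun n => (z (φ n) 1).2) atTop (𝓝 (θ 1)) := by
  have hp := hpq.lt
  set M : NNReal := ⟨fieldBound p C, fieldBound_nonneg hp hC.nonneg⟩ with hM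
  have hbd : ∀ n x, ‖polarField p q S T a α β κ x (z n x)‖ ≤ M := fun n x =>
    h.norm_polarField_le hpq hC x (z n x)
  have hlip : ∀ n, LipschitzWith M (z n) := fun n =>
    lipschitzWith_of_hasDerivAt_bound M (hz n) (hbd n)
  have hder : ∀ n x, HasDerivAt (fun x => (z n x).2) (polarField p q S T a α β κ x (z n x)).2 x :=
    fun n x => (hasFDerivAt_snd (𝕜 := ℝ) (p := z n x)).comp_hasDerivAt x (hz n x)
  have hwc : ∀ n, Continuous fun x => (polarField p q S T a α β κ x (z n x)).2 := fun n =>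
    ((h.continuous_polarField hpq ha hα hβ hκ).comp
      (continuous_id.prodMk (hlip n).continuous)).snd
  have hρ : ∀ x, Tendsto (fun n => (z n x).1) atTop l := by
    intro x
    refine tendsto_of_abs_sub_le hl hR (B := M * |x|) fun n => ?_
    have h1 := (hlip n).dist_le_mul x 0
    rw [Real.dist_eq, sub_zero, hz0] at h1
    refine le_trans ?_ h1
    rw [Prod.dist_eq]
    exact le_max_left _ _
  have hwM : ∀ n x, ‖(polarField p q S T a α β κ x (z n x)).2‖ ≤ M := fun n x =>
    (norm_snd_le _).trans (hbd n x)
  obtain ⟨φ, hφ, θ, hθ, hlimθ⟩ := exists_subseq_tendsto_solution (angularSpeed p S a α β μ)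
    (h.continuous_angularSpeed hp ha hα hβ μ) M 0 (fun n x => (z n x).2)
    (fun n => lipschitzWith_of_hasDerivAt_bound M (hder n) (hwM n))
    (fun n => by simp [hz0]) (fun n x => (polarField p q S T a α β κ x (z n x)).2) hwc hwM
    (fun x => Eventually.of_forall fun n =>
      eq_add_integral_of_hasDerivAt (hder n) (hwc n) x)
    (fun _ t => t) (fun t => tendsto_const_nhds) (fun t => by
      have h1 : Tendsto (fun n => (κ (Real.exp (z n t).1 * S (z n t).2) - μ) * |S (z n t).2| ^ p)
          atTop (𝓝 0) := by
        rw [Metric.tendsto_nhds]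
        intro ε hε
        filter_upwards [(hρ t).eventually (hlim ε hε)] with n hn
        rw [Real.dist_eq, sub_zero]
        exact hn _ (h.abs_fst_le hp _)
      have h2 := h1.const_mul (a t)
      rw [mul_zero] at h2
      refine h2.congr fun n => ?_
      rw [h.polarField_snd hpq μ]
      ring)
  refine ⟨φ, hφ, θ, ?_, hθ, hlimθ 1⟩
  have := hlimθ 0
  simp only [hz0] at this
  exact (tendsto_nhds_unique this tendsto_const_nhds)

lemma eventually_forall_of_seq {l : Filter ℝ} [l.IsCountablyGenerated] {P : ℝ → Prop}
    (h : ∀ R : ℕ → ℝ, Tendsto R atTop l → ¬ ∀ n, ¬ P (R n)) : ∀ᶠ r in l, P r := by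
  by_contra hcon
  obtain ⟨R, hR, hn⟩ := exists_seq_forall_of_frequently (not_eventually.1 hcon)
  exact h R hR hn

lemma IsGenSine.eventually_angle_gt (h : IsGenSine p q ν S T) (hpq : p.HolderConjugate q)
    (ha : Continuous a) (hα : Continuous α) (hβ : Continuous β) (hκ : Continuous κ)
    (hapos : ∀ x, 0 < a x) {C C' μ lam : ℝ}
    (hC : CoeffBound C a α β κ) (hC' : CoeffBound C' a α β (fun _ => lam))
    {l : Filter ℝ} (hl : l = atBot ∨ l = atTop)
    (hlim : ∀ ε > 0, ∀ᶠ r in l, ∀ s, |s| ≤ 1 → |(κ (Real.exp r * s) - μ) * |s| ^ p| < ε)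
    (hμ : lam < μ) {θ : ℝ → ℝ} (hθ0 : θ 0 = 0)
    (hθ : ∀ x, HasDerivAt θ (angularSpeed p S a α β lam x (θ x)) x) :
    ∀ᶠ R in l, ∀ z : ℝ → ℝ × ℝ, z 0 = (R, 0) →
      (∀ x, HasDerivAt z (polarField p q S T a α β κ x (z x)) x) → θ 1 < (z 1).2 := by
  have : l.IsCountablyGenerated := by rcases hl with rfl | rfl <;> infer_instance
  refine eventually_forall_of_seq fun R hR hcon => ?_
  push Not at hcon
  choose z hz0 hz hle using hcon
  obtain ⟨φ, -, θ', hθ'0, hθ', hlim'⟩ :=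
    h.exists_subseq_tendsto_angle hpq ha hα hβ hκ hC hl hlim hR hz0 hz
  have h1 : θ' 1 ≤ θ 1 := le_of_tendsto' hlim' fun n => hle (φ n)
  exact h1.not_gt (h.angle_lt hpq hC' hapos hμ zero_lt_one hθ hθ' (by rw [hθ0, hθ'0]))

lemma IsGenSine.eventually_angle_lt (h : IsGenSine p q ν S T) (hpq : p.HolderConjugate q)
    (ha : Continuous a) (hα : Continuous α) (hβ : Continuous β) (hκ : Continuous κ)
    (hapos : ∀ x, 0 < a x) {C C' μ lam : ℝ}
    (hC : CoeffBound C a α β κ) (hC' : CoeffBound C' a α β (fun _ => μ))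
    {l : Filter ℝ} (hl : l = atBot ∨ l = atTop)
    (hlim : ∀ ε > 0, ∀ᶠ r in l, ∀ s, |s| ≤ 1 → |(κ (Real.exp r * s) - μ) * |s| ^ p| < ε)
    (hμ : μ < lam) {θ : ℝ → ℝ} (hθ0 : θ 0 = 0)
    (hθ : ∀ x, HasDerivAt θ (angularSpeed p S a α β lam x (θ x)) x) :
    ∀ᶠ R in l, ∀ z : ℝ → ℝ × ℝ, z 0 = (R, 0) →
      (∀ x, HasDerivAt z (polarField p q S T a α β κ x (z x)) x) → (z 1).2 < θ 1 := by
  have : l.IsCountablyGenerated := by rcases hl with rfl | rfl <;> infer_instance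
  refine eventually_forall_of_seq fun R hR hcon => ?_
  push Not at hcon
  choose z hz0 hz hle using hcon
  obtain ⟨φ, -, θ', hθ'0, hθ', hlim'⟩ :=
    h.exists_subseq_tendsto_angle hpq ha hα hβ hκ hC hl hlim hR hz0 hz
  have h1 : θ 1 ≤ θ' 1 := ge_of_tendsto' hlim' fun n => hle (φ n)
  exact h1.not_gt (h.angle_lt hpq hC' hapos hμ zero_lt_one hθ' hθ (by rw [hθ0, hθ'0]))

end Asymptotics

section Lift

lemma exists_pos_of_hasDerivAt_pos {w : ℝ → ℝ} {d : ℝ} (h : HasDerivAt w d 0) (h0 : w 0 = 0)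
    (hd : 0 < d) : ∃ δ > 0, ∀ x ∈ Ioo (0 : ℝ) δ, 0 < w x := by
  have h1 := (hasDerivAt_iff_tendsto_slope.1 h).eventually (lt_mem_nhds hd)
  have h2 : ∀ᶠ x in 𝓝[>] (0 : ℝ), 0 < slope w 0 x :=
    h1.filter_mono (nhdsWithin_mono _ fun x hx => ne_of_gt hx)
  obtain ⟨δ, hδ, h3⟩ := mem_nhdsGT_iff_exists_Ioo_subset.1 h2
  refine ⟨δ, hδ, fun x hx => ?_⟩
  have h4 : 0 < slope w 0 x := h3 hx
  rw [slope_def_field, h0, sub_zero, sub_zero] at h4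
  exact (div_pos_iff_of_pos_right hx.1).1 h4

variable {p q ν : ℝ} {S T a α β : ℝ → ℝ}

lemma IsGenSine.exists_local_lift (h : IsGenSine p q ν S T) (hpq : p.HolderConjugate q)
    {κ : ℝ → ℝ} {γ : ℝ → ℝ × ℝ} (hγ : Continuous γ) {x₀ c : ℝ} (hx₀ : x₀ < c)
    (hd : ∀ x ∈ Ioo x₀ c, HasDerivAt γ (phip q (γ x).2, -(a x * κ (γ x).1 * phip p (γ x).1
      + α x * phip p (max (γ x).1 0) + β x * phip p (-min (γ x).1 0))) x)
    {z₀ : ℝ × ℝ} (hz₀ : polarMap p S T z₀ = γ x₀) :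
    ∃ x₁ ∈ Ioo x₀ c, ∃ y : ℝ → ℝ × ℝ, y x₀ = z₀ ∧ ContinuousOn y (Icc x₀ x₁) ∧
      (∀ x ∈ Icc x₀ x₁, polarMap p S T (y x) = γ x) ∧
      ∀ x ∈ Ioo x₀ x₁, HasDerivAt y (polarField p q S T a α β κ x (y x)) x := by
  obtain ⟨L, hL⟩ := h.exists_equiv_polarDeriv hpq z₀
  have hst := h.hasStrictFDerivAt_polarMap hpq z₀
  rw [← hL] at hst
  set e := hst.toOpenPartialHomeomorph (polarMap p S T) with he
  have hsrc : z₀ ∈ e.source := hst.mem_toOpenPartialHomeomorph_source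
  have htgt : γ x₀ ∈ e.target := hz₀ ▸ hst.image_mem_toOpenPartialHomeomorph_target
  have hnhds : γ ⁻¹' e.target ∈ 𝓝 x₀ := (e.open_target.preimage hγ).mem_nhds htgt
  obtain ⟨δ, hδ, hball⟩ := Metric.mem_nhds_iff.1 hnhds
  set x₁ := min (x₀ + δ / 2) ((x₀ + c) / 2) with hx₁
  have h01 : x₀ < x₁ := lt_min (by linarith) (by linarith)
  have h1c : x₁ < c := (min_le_right _ _).trans_lt (by linarith)
  have hmem : ∀ x ∈ Icc x₀ x₁, γ x ∈ e.target := by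
    intro x hx
    refine hball ?_
    rw [Metric.mem_ball, Real.dist_eq, abs_of_nonneg (by linarith [hx.1])]
    have := hx.2.trans (min_le_left _ _)
    linarith
  have hmap : ∀ x ∈ Icc x₀ x₁, polarMap p S T (e.symm (γ x)) = γ x := fun x hx =>
    e.right_inv (hmem x hx)
  refine ⟨x₁, ⟨h01, h1c⟩, fun x => e.symm (γ x), ?_, ?_, hmap, ?_⟩
  · simp only
    rw [← hz₀]
    exact e.left_inv hsrc
  · exact e.symm.continuousOn.comp hγ.continuousOn hmem
  · intro x hx
    have hxc := Ioo_subset_Icc_self hx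
    obtain ⟨L', hL'⟩ := h.exists_equiv_polarDeriv hpq (e.symm (γ x))
    have h2 : HasFDerivAt e (L' : ℝ × ℝ →L[ℝ] ℝ × ℝ) (e.symm (γ x)) := by
      rw [hL']
      exact (h.hasStrictFDerivAt_polarMap hpq _).hasFDerivAt
    have h3 := (e.hasFDerivAt_symm (hmem x hxc) h2).comp_hasDerivAt x
      (hd x ⟨hx.1, hx.2.trans h1c⟩)
    have h4 := h.polarDeriv_polarField hpq (a := a) (α := α) (β := β) (κ := κ) x (e.symm (γ x))
    rw [hmap x hxc, ← hL'] at h4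
    rw [← h4] at h3
    erw [L'.symm_apply_apply] at h3
    exact h3

/-- For constant `κ` the polar system has unique forward solutions. -/
lemma IsGenSine.polarField_unique (h : IsGenSine p q ν S T) (hpq : p.HolderConjugate q)
    {C lam : ℝ} (hC : CoeffBound C a α β (fun _ => lam)) (ha : ∀ x, 0 < a x) {b c : ℝ}
    {y z : ℝ → ℝ × ℝ} (hyc : ContinuousOn y (Icc b c)) (hzc : ContinuousOn z (Icc b c))
    (hy : ∀ x ∈ Ioo b c, HasDerivAt y (polarField p q S T a α β (fun _ => lam) x (y x)) x)
    (hz : ∀ x ∈ Ioo b c, HasDerivAt z (polarField p q S T a α β (fun _ => lam) x (z x)) x)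
    (h0 : y b = z b) : ∀ x ∈ Icc b c, y x = z x := by
  have fst' : ∀ w : ℝ → ℝ × ℝ,
      (∀ x ∈ Ioo b c, HasDerivAt w (polarField p q S T a α β (fun _ => lam) x (w x)) x) →
      ∀ x ∈ Ioo b c, HasDerivAt (fun x => (w x).1)
        (polarField p q S T a α β (fun _ => lam) x (w x)).1 x :=
    fun w hw x hx => (hasFDerivAt_fst (𝕜 := ℝ) (p := w x)).comp_hasDerivAt x (hw x hx)
  have snd' : ∀ w : ℝ → ℝ × ℝ,
      (∀ x ∈ Ioo b c, HasDerivAt w (polarField p q S T a α β (fun _ => lam) x (w x)) x) →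
      ∀ x ∈ Ioo b c, HasDerivAt (fun x => (w x).2) (angularSpeed p S a α β lam x (w x).2) x := by
    intro w hw x hx
    have h1 := (hasFDerivAt_snd (𝕜 := ℝ) (p := w x)).comp_hasDerivAt x (hw x hx)
    have h2 := h.polarField_snd hpq (a := a) (α := α) (β := β) (κ := fun _ => lam) lam x (w x)
    rw [sub_self, zero_mul, mul_zero, add_zero] at h2
    rw [← h2]
    exact h1
  have hsnd : ∀ x ∈ Icc b c, (y x).2 = (z x).2 := fun x hx => le_antisymm
    (h.angle_le hpq hC ha le_rfl hyc.snd hzc.snd (snd' y hy) (snd' z hz) (by rw [h0]) x hx)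
    (h.angle_le hpq hC ha le_rfl hzc.snd hyc.snd (snd' z hz) (snd' y hy) (by rw [h0]) x hx)
  have heq : ∀ x ∈ Ioo b c, (polarField p q S T a α β (fun _ => lam) x (y x)).1
      = (polarField p q S T a α β (fun _ => lam) x (z x)).1 := by
    intro x hx
    simp only [polarField, scaledNonlin, hsnd x (Ioo_subset_Icc_self hx)]
  intro x hx
  refine Prod.ext (le_antisymm ?_ ?_) (hsnd x hx)
  · refine sub_nonneg.1 (nonneg_of_neg_mul_abs_le_deriv (D := fun x => (z x).1 - (y x).1)
      (K := 0) (hzc.fst.sub hyc.fst) (fun x hx => (fst' z hz x hx).sub (fst' y hy x hx))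
      (fun x hx => ?_) (by simp [h0]) x hx)
    simp [heq x hx]
  · refine sub_nonneg.1 (nonneg_of_neg_mul_abs_le_deriv (D := fun x => (y x).1 - (z x).1)
      (K := 0) (hyc.fst.sub hzc.fst) (fun x hx => (fst' y hy x hx).sub (fst' z hz x hx))
      (fun x hx => ?_) (by simp [h0]) x hx)
    simp [heq x hx]

/-- A solution of the half-linear equation follows the trajectory of the polar system. -/
lemma IsGenSine.polarMap_eq_of_hasDerivAt (h : IsGenSine p q ν S T) (hpq : p.HolderConjugate q)
    {C lam : ℝ} (hC : CoeffBound C a α β (fun _ => lam)) (ha : ∀ x, 0 < a x) {b c : ℝ}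
    {γ : ℝ → ℝ × ℝ} (hγ : Continuous γ)
    (hd : ∀ x ∈ Ioo b c, HasDerivAt γ (phip q (γ x).2, -(a x * lam * phip p (γ x).1
      + α x * phip p (max (γ x).1 0) + β x * phip p (-min (γ x).1 0))) x)
    {y : ℝ → ℝ × ℝ}
    (hy : ∀ x, HasDerivAt y (polarField p q S T a α β (fun _ => lam) x (y x)) x)
    (h0 : polarMap p S T (y b) = γ b) : ∀ x ∈ Icc b c, polarMap p S T (y x) = γ x := by
  have hyc : Continuous y := continuous_iff_continuousAt.2 fun x => (hy x).continuousAt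
  have hpc : Continuous (polarMap p S T) := continuous_iff_continuousAt.2 fun w =>
    (h.hasStrictFDerivAt_polarMap hpq w).continuousAt
  refine IsClosed.Icc_subset_of_forall_exists_gt (s := {x | polarMap p S T (y x) = γ x})
    ((isClosed_eq (hpc.comp hyc) hγ).inter isClosed_Icc) h0 ?_
  rintro x ⟨hx, hxI⟩ c' hc'
  obtain ⟨x₁, hx₁, w, hw0, hwc, hwm, hw⟩ := h.exists_local_lift hpq (κ := fun _ => lam) hγ
    (lt_min hxI.2 hc') (fun t ht => hd t ⟨hxI.1.trans_lt ht.1, ht.2.trans_le (min_le_left _ _)⟩) hx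
  refine ⟨x₁, ?_, hx₁.1, hx₁.2.le.trans (min_le_right _ _)⟩
  have h1 : x₁ ∈ Icc x x₁ := ⟨hx₁.1.le, le_rfl⟩
  have h2 := h.polarField_unique hpq hC ha hwc hyc.continuousOn hw (fun t _ => hy t) hw0 x₁ h1
  change polarMap p S T (y x₁) = γ x₁
  rw [← h2]
  exact hwm x₁ h1

lemma IsGenSine.exists_polarMap_eq (h : IsGenSine p q ν S T) (hp : 1 < p) {v : ℝ}
    (hv : 0 < ν * v) : ∃ r, polarMap p S T (r, 0) = (0, v) := by
  have h0 := h.snd_zero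
  have hp1 : p - 1 ≠ 0 := by linarith
  have hT : T 0 ≠ 0 := by
    intro h1
    simp [h1] at h0
  have hpos : 0 < v / T 0 := by
    have h1 : 0 < ν * v / (ν * T 0) := div_pos hv h0
    rwa [mul_div_mul_left] at h1
    rintro rfl
    simp at h0
  refine ⟨Real.log (v / T 0) / (p - 1), ?_⟩
  simp only [polarMap, h.fst_zero, mul_zero]
  rw [mul_div_cancel₀ _ hp1, Real.exp_log hpos, div_mul_cancel₀ _ hT]

end Lift

section Counting

lemma le_of_forall_deriv_pos_of_eq {θ θ' : ℝ → ℝ} {c x₀ x : ℝ} (hθ : ∀ x, HasDerivAt θ (θ' x) x)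
    (hpos : ∀ x, θ x = c → 0 < θ' x) (h0 : c ≤ θ x₀) (hx : x₀ ≤ x) : c ≤ θ x := by
  have hc : Continuous θ := continuous_iff_continuousAt.2 fun x => (hθ x).continuousAt
  by_contra! hneg
  obtain ⟨t, ht, hmax⟩ := (isCompact_Icc.inter_right (isClosed_Ici.preimage hc)).exists_isGreatest
    ⟨x₀, ⟨le_rfl, hx⟩, (h0 : θ x₀ ∈ Ici c)⟩
  have htc : c ≤ θ t := ht.2
  have htx : t < x := lt_of_le_of_ne ht.1.2 fun h => by
    rw [h] at htc
    linarith
  have hev : ∀ᶠ y in 𝓝[>] t, c ≤ θ y := by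
    rcases htc.eq_or_lt with h | h
    · have h1 := (hasDerivAt_iff_tendsto_slope.1 (hθ t)).eventually (lt_mem_nhds (hpos t h.symm))
      filter_upwards [h1.filter_mono (nhdsWithin_mono _ fun x hx => ne_of_gt hx),
        self_mem_nhdsWithin] with y hy hty
      rw [slope_def_field, ← h, div_pos_iff_of_pos_right (sub_pos.2 hty)] at hy
      linarith
    · exact (((hc.tendsto t).eventually (lt_mem_nhds h)).filter_mono nhdsWithin_le_nhds).mono
        fun y hy => hy.le
  obtain ⟨y, hy, hty⟩ := (hev.and (Ioo_mem_nhdsGT htx)).exists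
  exact (hmax ⟨⟨ht.1.1.trans hty.1.le, hty.2.le⟩, hy⟩).not_gt hty.1

lemma lt_of_forall_deriv_pos_of_eq {θ θ' : ℝ → ℝ} {c x₀ x : ℝ} (hθ : ∀ x, HasDerivAt θ (θ' x) x)
    (hpos : ∀ x, θ x = c → 0 < θ' x) (h0 : c ≤ θ x₀) (hx : x₀ < x) : c < θ x := by
  refine lt_of_le_of_ne (le_of_forall_deriv_pos_of_eq hθ hpos h0 hx.le) fun h => ?_
  have h1 := (hasDerivAt_iff_tendsto_slope.1 (hθ x)).eventually (lt_mem_nhds (hpos x h.symm))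
  have h3 : ∀ᶠ y in 𝓝[<] x, 0 < slope θ x y :=
    h1.filter_mono (nhdsWithin_mono _ fun y hy => ne_of_lt hy)
  obtain ⟨y, hy, hyx⟩ := (h3.and (Ioo_mem_nhdsLT hx)).exists
  rw [slope_def_field, ← h] at hy
  have h2 := le_of_forall_deriv_pos_of_eq hθ hpos h0 hyx.1.le
  exact hy.not_ge (div_nonpos_of_nonneg_of_nonpos (by linarith) (by linarith [hyx.2]))

/-- If `θ` crosses the zeros of `S` only upwards then it puts the zeros of `S ∘ θ` in bijection
with the zeros of `S`. -/
lemma bijOn_zeros {S θ θ' : ℝ → ℝ} (hθ : ∀ x, HasDerivAt θ (θ' x) x)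
    (hpos : ∀ x, S (θ x) = 0 → 0 < θ' x) (h0 : θ 0 = 0) (hS0 : S 0 = 0) :
    BijOn θ {x ∈ Ioo (0 : ℝ) 1 | S (θ x) = 0} {t ∈ Ioo 0 (θ 1) | S t = 0} := by
  have hc : Continuous θ := continuous_iff_continuousAt.2 fun x => (hθ x).continuousAt
  have key : ∀ x y, S (θ x) = 0 → x < y → θ x < θ y := fun x y hx hxy =>
    lt_of_forall_deriv_pos_of_eq hθ (fun w hw => hpos w (by rw [hw, hx])) le_rfl hxy
  refine ⟨?_, ?_, ?_⟩
  · rintro x ⟨hx, hSx⟩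
    refine ⟨⟨?_, key x 1 hSx hx.2⟩, hSx⟩
    have := key 0 x (by rw [h0, hS0]) hx.1
    rwa [h0] at this
  · rintro x ⟨-, hSx⟩ y ⟨-, hSy⟩ hxy
    rcases lt_trichotomy x y with h | h | h
    · exact absurd hxy (key x y hSx h).ne
    · exact h
    · exact absurd hxy (key y x hSy h).ne'
  · rintro t ⟨ht, hSt⟩
    rw [← h0] at ht
    obtain ⟨x, hx, rfl⟩ := intermediate_value_Ioo zero_le_one hc.continuousOn ht
    exact ⟨x, ⟨hx, hSt⟩, rfl⟩

end Counting

section Coefficients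

lemma exists_coeffBound {a α β κ : ℝ → ℝ} (ha : ∃ C, ∀ x, |a x| ≤ C) (hα : ∃ C, ∀ x, |α x| ≤ C)
    (hβ : ∃ C, ∀ x, |β x| ≤ C) (hκ : ∃ C, ∀ s, |κ s| ≤ C) : ∃ C, CoeffBound C a α β κ := by
  obtain ⟨A, hA⟩ := ha
  obtain ⟨B, hB⟩ := hα
  obtain ⟨D, hD⟩ := hβ
  obtain ⟨K, hK⟩ := hκ
  have hA0 := (abs_nonneg _).trans (hA 0)
  have hB0 := (abs_nonneg _).trans (hB 0)
  have hD0 := (abs_nonneg _).trans (hD 0)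
  have hK0 := (abs_nonneg _).trans (hK 0)
  have hAK := mul_nonneg hA0 hK0
  refine ⟨A * K + B + D, fun x s => ?_, fun x => ?_, fun x => ?_⟩
  · rw [abs_mul]
    have := mul_le_mul (hA x) (hK s) (abs_nonneg _) hA0
    linarith
  · linarith [hB x]
  · linarith [hD x]

/-- A continuous function on `[0,1]` has a bounded continuous extension to `ℝ` whose values are
all attained on `[0,1]`. -/
lemma exists_clamp {a : ℝ → ℝ} (ha : ContinuousOn a (Icc 0 1)) : ∃ b : ℝ → ℝ, Continuous b ∧
    (∀ x ∈ Icc (0 : ℝ) 1, b x = a x) ∧ (∀ x, ∃ y ∈ Icc (0 : ℝ) 1, b x = a y) ∧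
    ∃ C, ∀ x, |b x| ≤ C := by
  have hmem : ∀ x : ℝ, max 0 (min x 1) ∈ Icc (0 : ℝ) 1 := fun x =>
    ⟨le_max_left _ _, max_le zero_le_one (min_le_right _ _)⟩
  obtain ⟨C, hC⟩ := isCompact_Icc.exists_bound_of_continuousOn ha
  refine ⟨fun x => a (max 0 (min x 1)), ha.comp_continuous (by fun_prop) hmem, fun x hx => ?_,
    fun x => ⟨_, hmem x, rfl⟩, C, fun x => hC _ (hmem x)⟩
  simp only [min_eq_left hx.2, max_eq_right hx.1]

lemma exists_quotient_phip {p f0 finf : ℝ} (hp : 1 < p) {f : ℝ → ℝ} (hf : Continuous f)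
    (hf0 : Tendsto (fun s => f s / phip p s) (𝓝[≠] (0:ℝ)) (𝓝 f0))
    (hfinf : Tendsto (fun s => f s / phip p s) (atBot ⊔ atTop) (𝓝 finf)) :
    ∃ g : ℝ → ℝ, Continuous g ∧ g 0 = f0 ∧ Tendsto g (atBot ⊔ atTop) (𝓝 finf) ∧
      (∃ C, ∀ s, |g s| ≤ C) ∧ ∀ s, f s = g s * phip p s := by
  classical
  set g := Function.update (fun s => f s / phip p s) 0 f0 with hg
  have hgne : ∀ s, s ≠ 0 → g s = f s / phip p s := fun s hs => Function.update_of_ne hs _ _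
  have hg0 : g 0 = f0 := Function.update_self _ _ _
  have hgc : Continuous g := by
    rw [continuous_iff_continuousAt]
    intro s
    rcases eq_or_ne s 0 with rfl | hs
    · exact continuousAt_update_same.2 hf0
    · exact (hf.continuousAt.div (continuous_phip hp).continuousAt (phip_ne_zero hs)).congr
        ((eventually_ne_nhds hs).mono fun t ht => (hgne t ht).symm)
  have hginf : Tendsto g (atBot ⊔ atTop) (𝓝 finf) := by
    refine hfinf.congr' ?_
    have h1 : ∀ᶠ s : ℝ in atBot ⊔ atTop, s ≠ 0 :=
      eventually_sup.2 ⟨eventually_ne_atBot 0, eventually_ne_atTop 0⟩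
    exact h1.mono fun s hs => (hgne s hs).symm
  refine ⟨g, hgc, hg0, hginf, ?_, ?_⟩
  · have h1 := hginf.abs.eventually (gt_mem_nhds (lt_add_one |finf|))
    rw [← cocompact_eq_atBot_atTop] at h1
    obtain ⟨t, ht, hts⟩ := mem_cocompact.1 h1
    obtain ⟨C, hC⟩ := ht.exists_bound_of_continuousOn hgc.continuousOn
    refine ⟨max C (|finf| + 1), fun s => ?_⟩
    by_cases hs : s ∈ t
    · exact (hC s hs).trans (le_max_left _ _)
    · have : |g s| < |finf| + 1 := hts hs
      exact this.le.trans (le_max_right _ _)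
  · have h2 : f 0 = 0 := by
      have h3 : Tendsto (fun s => g s * phip p s) (𝓝[≠] 0) (𝓝 (g 0 * phip p 0)) :=
        ((hgc.mul (continuous_phip hp)).tendsto 0).mono_left nhdsWithin_le_nhds
      rw [phip_zero, mul_zero] at h3
      refine tendsto_nhds_unique ((hf.tendsto 0).mono_left nhdsWithin_le_nhds) (h3.congr' ?_)
      filter_upwards [self_mem_nhdsWithin] with s hs
      rw [hgne s hs, div_mul_cancel₀ _ (phip_ne_zero hs)]
    intro s
    rcases eq_or_ne s 0 with rfl | hs
    · rw [h2, phip_zero, mul_zero]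
    · rw [hgne s hs, div_mul_cancel₀ _ (phip_ne_zero hs)]

end Coefficients

section Nodal

variable {p q ν : ℝ} {S T a α β a' α' β' : ℝ → ℝ}

lemma deriv_sign_of_memS {k : ℕ} {u : ℝ → ℝ} (hu : MemS k ν u) : 0 < ν * deriv u 0 := by
  obtain ⟨⟨hC1, h0, -⟩, -, -, hsimple, δ, hδ, hpos⟩ := hu
  have hd : HasDerivAt u (deriv u 0) 0 := (hC1.differentiable one_ne_zero 0).hasDerivAt
  have hν : ν ≠ 0 := by
    rintro rfl
    have := hpos (δ / 2) ⟨by linarith, by linarith⟩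
    simp at this
  by_contra! hle
  have hlt := lt_of_le_of_ne hle (mul_ne_zero hν (hsimple 0 ⟨le_rfl, zero_le_one⟩ h0))
  obtain ⟨δ', hδ', hneg⟩ := exists_pos_of_hasDerivAt_pos (hd.const_mul (-ν)) (by simp [h0])
    (by linarith)
  have hm := lt_min hδ hδ'
  have h1 := hpos (min δ δ' / 2) ⟨by linarith, by linarith [min_le_left δ δ']⟩
  have h2 := hneg (min δ δ' / 2) ⟨by linarith, by linarith [min_le_right δ δ']⟩
  linarith

lemma IsGenSine.angularSpeed_pos (hp : 1 < p) {t : ℝ} (μ x : ℝ) (ht : S t = 0) :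
    0 < angularSpeed p S a α β μ x t := by
  rw [angularSpeed_of_fst_eq_zero hp ht]
  exact one_pos

/-- An eigenfunction yields a trajectory of the angular equation that determines its zeros. -/
lemma IsGenSine.exists_angle_of_isHalfSol (h : IsGenSine p q ν S T) (hpq : p.HolderConjugate q)
    (ha : Continuous a) (hα : Continuous α) (hβ : Continuous β) (hapos : ∀ x, 0 < a x)
    (hea : ∀ x ∈ Icc (0 : ℝ) 1, a x = a' x) (heα : ∀ x ∈ Icc (0 : ℝ) 1, α x = α' x)
    (heβ : ∀ x ∈ Icc (0 : ℝ) 1, β x = β' x) {C lam : ℝ}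
    (hC : CoeffBound C a α β (fun _ => lam)) {k : ℕ} {u : ℝ → ℝ}
    (hsol : IsHalfSol p a' α' β' lam u) (hu : MemS k ν u) :
    ∃ θ : ℝ → ℝ, θ 0 = 0 ∧ (∀ x, HasDerivAt θ (angularSpeed p S a α β lam x (θ x)) x) ∧
      S (θ 1) = 0 ∧ {t ∈ Ioo 0 (θ 1) | S t = 0}.Finite ∧
      {t ∈ Ioo 0 (θ 1) | S t = 0}.ncard = k - 1 := by
  have hp := hpq.lt
  obtain ⟨⟨hC1, hu0, hu1⟩, hder⟩ := hsol
  have hsgn := deriv_sign_of_memS hu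
  obtain ⟨-, hfin, hcard, -, -⟩ := hu
  have hV0 : 0 < ν * phip p (deriv u 0) := by
    have h1 : deriv u 0 ≠ 0 := fun h0 => by simp [h0] at hsgn
    have h2 : 0 < |deriv u 0| ^ (p - 2) := Real.rpow_pos_of_pos (abs_pos.2 h1) _
    have h3 : ν * phip p (deriv u 0) = |deriv u 0| ^ (p - 2) * (ν * deriv u 0) := by
      unfold phip
      ring
    rw [h3]
    exact mul_pos h2 hsgn
  obtain ⟨r, hr⟩ := h.exists_polarMap_eq hp hV0
  obtain ⟨y, hy0, hy⟩ := exists_global_solution (polarField p q S T a α β (fun _ => lam))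
    (h.continuous_polarField hpq ha hα hβ continuous_const)
    ⟨fieldBound p C, fieldBound_nonneg hp hC.nonneg⟩
    (fun x e => h.norm_polarField_le hpq hC x e) (r, 0)
  have hγ : Continuous fun x => (u x, phip p (deriv u x)) :=
    hC1.continuous.prodMk ((continuous_phip hp).comp (hC1.continuous_deriv le_rfl))
  have hpol := h.polarMap_eq_of_hasDerivAt hpq hC hapos hγ (b := 0) (c := 1) (fun x hx => by
    have hxc := Ioo_subset_Icc_self hx
    have h1 : HasDerivAt u (deriv u x) x := (hC1.differentiable one_ne_zero x).hasDerivAt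
    have h2 := hder x hx
    rw [← hea x hxc, ← heα x hxc, ← heβ x hxc, mul_comm lam] at h2
    simpa only [phip_phip hpq] using h1.prodMk h2) hy (by rw [hy0, hr, hu0])
  have hzero : ∀ x ∈ Icc (0 : ℝ) 1, S (y x).2 = 0 ↔ u x = 0 := by
    intro x hx
    have h1 := congrArg Prod.fst (hpol x hx)
    simp only [polarMap] at h1
    rw [← h1, mul_eq_zero, or_iff_right (Real.exp_pos _).ne']
  have hθ : ∀ x, HasDerivAt (fun x => (y x).2) (angularSpeed p S a α β lam x (y x).2) x := by
    intro x
    have h1 := (hasFDerivAt_snd (𝕜 := ℝ) (p := y x)).comp_hasDerivAt x (hy x)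
    have h2 := h.polarField_snd hpq (a := a) (α := α) (β := β) (κ := fun _ => lam) lam x (y x)
    rw [sub_self, zero_mul, mul_zero, add_zero] at h2
    rw [← h2]
    exact h1
  have hset : {x ∈ Ioo (0 : ℝ) 1 | S (y x).2 = 0} = {x ∈ Ioo (0 : ℝ) 1 | u x = 0} := by
    ext x
    exact and_congr_right fun hx => hzero x (Ioo_subset_Icc_self hx)
  have hbij := bijOn_zeros hθ (fun x hx => IsGenSine.angularSpeed_pos hp lam x hx)
    (by simp [hy0]) h.fst_zero
  rw [hset] at hbij
  refine ⟨fun x => (y x).2, by simp [hy0], hθ, (hzero 1 ⟨zero_le_one, le_rfl⟩).2 hu1, ?_, ?_⟩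
  · rw [← hbij.image_eq]
    exact hfin.image _
  · rw [← hbij.image_eq, hbij.injOn.ncard_image, hcard]

/-- A trajectory of the polar field hitting a zero of `S` yields a nodal solution. -/
lemma IsGenSine.exists_isSolNod (h : IsGenSine p q ν S T) (hpq : p.HolderConjugate q)
    (hea : ∀ x ∈ Icc (0 : ℝ) 1, a x = a' x) (heα : ∀ x ∈ Icc (0 : ℝ) 1, α x = α' x)
    (heβ : ∀ x ∈ Icc (0 : ℝ) 1, β x = β' x) {r : ℝ} {f g : ℝ → ℝ}
    (hfg : ∀ s, f s = g s * phip p s) {k : ℕ} {z : ℝ → ℝ × ℝ}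
    (hz : ∀ x, HasDerivAt z (polarField p q S T a α β (fun s => r * g s) x (z x)) x)
    (hz0 : (z 0).2 = 0) (hS : S (z 1).2 = 0) (hfin : {t ∈ Ioo 0 (z 1).2 | S t = 0}.Finite)
    (hcard : {t ∈ Ioo 0 (z 1).2 | S t = 0}.ncard = k - 1) :
    ∃ u : ℝ → ℝ, IsSolNod p r a' α' β' f u ∧ {x ∈ Ioo (0:ℝ) 1 | u x = 0}.Finite ∧
      {x ∈ Ioo (0:ℝ) 1 | u x = 0}.ncard = k - 1 ∧
      ∃ δ > 0, ∀ x ∈ Ioo (0:ℝ) δ, 0 < ν * u x := by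
  have hp := hpq.lt
  have hq := hpq.symm.lt
  set u : ℝ → ℝ := fun x => (polarMap p S T (z x)).1 with hu
  set v : ℝ → ℝ := fun x => (polarMap p S T (z x)).2 with hv
  have hder := fun x => h.hasDerivAt_polarMap hpq (hz x)
  have hu' : ∀ x, HasDerivAt u (phip q (v x)) x := fun x =>
    HasFDerivAt.comp_hasDerivAt (f := fun t => polarMap p S T (z t)) x
      (hasFDerivAt_fst (𝕜 := ℝ) (p := polarMap p S T (z x))) (hder x)
  have hv' : ∀ x, HasDerivAt v (-(a x * (r * g (u x)) * phip p (u x)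
      + α x * phip p (max (u x) 0) + β x * phip p (-min (u x) 0))) x := fun x =>
    HasFDerivAt.comp_hasDerivAt (f := fun t => polarMap p S T (z t)) x
      (hasFDerivAt_snd (𝕜 := ℝ) (p := polarMap p S T (z x))) (hder x)
  have hdu : deriv u = fun x => phip q (v x) := funext fun x => (hu' x).deriv
  have hvc : Continuous v := continuous_iff_continuousAt.2 fun x => (hv' x).continuousAt
  have hzero : ∀ x, u x = 0 ↔ S (z x).2 = 0 := by
    intro x
    simp only [hu, polarMap]
    rw [mul_eq_zero, or_iff_right (Real.exp_pos _).ne']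
  have hset : {x ∈ Ioo (0 : ℝ) 1 | S (z x).2 = 0} = {x ∈ Ioo (0 : ℝ) 1 | u x = 0} := by
    ext x
    exact and_congr_right fun hx => (hzero x).symm
  have hθ : ∀ x, HasDerivAt (fun x => (z x).2)
      (polarField p q S T a α β (fun s => r * g s) x (z x)).2 x := fun x =>
    (hasFDerivAt_snd (𝕜 := ℝ) (p := z x)).comp_hasDerivAt x (hz x)
  have hbij := bijOn_zeros (S := S) hθ (fun x hx => by
    rw [h.polarField_snd hpq 0, angularSpeed_of_fst_eq_zero hp hx, hx, abs_zero,
      Real.zero_rpow (by linarith)]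
    simp) hz0 h.fst_zero
  rw [hset] at hbij
  have hu0 : u 0 = 0 := (hzero 0).2 (by rw [hz0, h.fst_zero])
  refine ⟨u, ⟨⟨?_, hu0, (hzero 1).2 hS⟩, fun x hx => ?_⟩, ?_, ?_, ?_⟩
  · rw [contDiff_one_iff_deriv, hdu]
    exact ⟨fun x => (hu' x).differentiableAt, (continuous_phip hq).comp hvc⟩
  · have hxc := Ioo_subset_Icc_self hx
    have h1 := hv' x
    simp only [hdu, phip_phip hpq.symm]
    rw [hea x hxc, heα x hxc, heβ x hxc] at h1
    convert h1 using 1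
    rw [hfg]
    ring
  · exact Set.Finite.of_finite_image (by rw [hbij.image_eq]; exact hfin) hbij.injOn
  · rw [← hbij.injOn.ncard_image, hbij.image_eq, hcard]
  · refine exists_pos_of_hasDerivAt_pos ((hu' 0).const_mul ν) (by simp [hu0]) ?_
    have hT0 : T 0 ≠ 0 := fun h0 => by simpa [h0] using h.snd_zero
    have h3 : ν * phip q (v 0) =
        Real.exp (z 0).1 * (|T 0| ^ (q - 2) * (ν * T 0)) := by
      simp only [hv, polarMap, hz0]
      rw [phip_exp_conj hpq, phip]
      ring
    rw [h3]
    have := Real.rpow_pos_of_pos (abs_pos.2 hT0) (q - 2)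
    exact mul_pos (Real.exp_pos _) (mul_pos this h.snd_zero)

end Nodal

/-- **Theorem 1.3**: existence of nodal solutions. -/
theorem stmt2 (p : ℝ) (hp : 1 < p)
    (a α β : ℝ → ℝ)
    (ha : ContinuousOn a (Icc 0 1)) (hapos : ∀ x ∈ Icc (0:ℝ) 1, 0 < a x)
    (hα : ContinuousOn α (Icc 0 1)) (hβ : ContinuousOn β (Icc 0 1))
    (f : ℝ → ℝ) (hf : Continuous f)
    -- (A1)
    (hA1 : ∀ s : ℝ, s ≠ 0 → 0 < s * f s)
    -- (A2)
    (f0 finf : ℝ) (hf0pos : 0 < f0) (hfinfpos : 0 < finf)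
    (hf0 : Tendsto (fun s => f s / phip p s) (𝓝[≠] (0:ℝ)) (𝓝 f0))
    (hfinf : Tendsto (fun s => f s / phip p s) (atBot ⊔ atTop) (𝓝 finf))
    (k : ℕ) (hk : 1 ≤ k) (ν : ℝ) (hν : ν = 1 ∨ ν = -1)
    -- λ_k^ν : the k-th half-eigenvalue
    (lamk : ℝ) (hlamk : ∃ u, IsHalfSol p a α β lamk u ∧ MemS k ν u)
    (r : ℝ)
    (hr : (lamk / finf < r ∧ r < lamk / f0) ∨ (lamk / f0 < r ∧ r < lamk / finf)) :
    ∃ u : ℝ → ℝ, IsSolNod p r a α β f u ∧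
      {x ∈ Ioo (0:ℝ) 1 | u x = 0}.Finite ∧
      {x ∈ Ioo (0:ℝ) 1 | u x = 0}.ncard = k - 1 ∧
      ∃ δ > 0, ∀ x ∈ Ioo (0:ℝ) δ, 0 < ν * u x := by
  have hpq := Real.HolderConjugate.conjExponent hp
  obtain ⟨S, T, h⟩ := exists_isGenSine hpq hν
  obtain ⟨a', ha', hea, hva, hba⟩ := exists_clamp ha
  obtain ⟨α', hα', heα, -, hbα⟩ := exists_clamp hα
  obtain ⟨β', hβ', heβ, -, hbβ⟩ := exists_clamp hβ
  obtain ⟨g, hg, hg0, hginf, hbg, hfg⟩ := exists_quotient_phip hp hf hf0 hfinf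
  have hapos' : ∀ x, 0 < a' x := fun x => by
    obtain ⟨y, hy, hxy⟩ := hva x
    rw [hxy]
    exact hapos y hy
  have hbκ : ∃ K, ∀ s, |r * g s| ≤ K := by
    obtain ⟨G, hG⟩ := hbg
    exact ⟨|r| * G, fun s => by rw [abs_mul]; exact mul_le_mul_of_nonneg_left (hG s) (abs_nonneg r)⟩
  have hκ : Continuous fun s => r * g s := continuous_const.mul hg
  have hconst : ∀ μ : ℝ, ∃ C, CoeffBound C a' α' β' (fun _ => μ) := fun μ =>
    exists_coeffBound hba hbα hbβ ⟨|μ|, fun _ => le_rfl⟩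
  obtain ⟨C, hC⟩ := exists_coeffBound hba hbα hbβ hbκ
  obtain ⟨Clam, hClam⟩ := hconst lamk
  obtain ⟨w, hw, hwS⟩ := hlamk
  obtain ⟨θ, hθ0, hθ, hθ1, hfin, hcard⟩ :=
    h.exists_angle_of_isHalfSol hpq ha' hα' hβ' hapos' hea heα heβ hClam hw hwS
  have hlim0 : ∀ ε > 0, ∀ᶠ R in atBot, ∀ s, |s| ≤ 1 →
      |(r * g (Real.exp R * s) - r * f0) * |s| ^ p| < ε := fun ε hε =>
    eventually_atBot_abs_sub_mul_rpow_lt hp hκ (by rw [hg0]) hε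
  have hlimtop : ∀ ε > 0, ∀ᶠ R in atTop, ∀ s, |s| ≤ 1 →
      |(r * g (Real.exp R * s) - r * finf) * |s| ^ p| < ε := fun ε hε => by
    obtain ⟨K, hK⟩ := hbκ
    exact eventually_atTop_abs_sub_mul_rpow_lt hp (hginf.const_mul r) hK hε
  obtain ⟨s₁, s₂, h₁, h₂⟩ : ∃ s₁ s₂ : ℝ,
      (∀ z : ℝ → ℝ × ℝ, z 0 = (s₁, 0) → (∀ x, HasDerivAt z
        (polarField p p.conjExponent S T a' α' β' (fun s => r * g s) x (z x)) x) →
        (z 1).2 < θ 1) ∧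
      (∀ z : ℝ → ℝ × ℝ, z 0 = (s₂, 0) → (∀ x, HasDerivAt z
        (polarField p p.conjExponent S T a' α' β' (fun s => r * g s) x (z x)) x) →
        θ 1 < (z 1).2) := by
    rcases hr with ⟨hr1, hr2⟩ | ⟨hr1, hr2⟩
    · rw [div_lt_iff₀ hfinfpos] at hr1
      rw [lt_div_iff₀ hf0pos] at hr2
      obtain ⟨C', hC'⟩ := hconst (r * f0)
      obtain ⟨s₁, h₁⟩ := (h.eventually_angle_lt hpq ha' hα' hβ' hκ hapos' hC hC' (Or.inl rfl)
        hlim0 hr2 hθ0 hθ).exists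
      obtain ⟨s₂, h₂⟩ := (h.eventually_angle_gt hpq ha' hα' hβ' hκ hapos' hC hClam (Or.inr rfl)
        hlimtop hr1 hθ0 hθ).exists
      exact ⟨s₁, s₂, h₁, h₂⟩
    · rw [div_lt_iff₀ hf0pos] at hr1
      rw [lt_div_iff₀ hfinfpos] at hr2
      obtain ⟨C', hC'⟩ := hconst (r * finf)
      obtain ⟨s₁, h₁⟩ := (h.eventually_angle_lt hpq ha' hα' hβ' hκ hapos' hC hC' (Or.inr rfl)
        hlimtop hr2 hθ0 hθ).exists
      obtain ⟨s₂, h₂⟩ := (h.eventually_angle_gt hpq ha' hα' hβ' hκ hapos' hC hClam (Or.inl rfl)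
        hlim0 hr1 hθ0 hθ).exists
      exact ⟨s₁, s₂, h₁, h₂⟩
  obtain ⟨z, hz, hz0, hz1⟩ := exists_solution_hitting
    (polarField p p.conjExponent S T a' α' β' (fun s => r * g s))
    (h.continuous_polarField hpq ha' hα' hβ' hκ)
    ⟨fieldBound p C, fieldBound_nonneg hp hC.nonneg⟩
    (fun x e => h.norm_polarField_le hpq hC x e) s₁ s₂ (θ 1)
    (fun z hz hz0 => h₁ z hz0 hz) (fun z hz hz0 => h₂ z hz0 hz)
  rw [← hz1] at hθ1 hfin hcard
  exact h.exists_isSolNod hpq hea heα heβ hfg hz hz0 hθ1 hfin hcard
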